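/- arXiv:2405.19810 — 3 statements merged into one kernel-verified Lean document; each statement's English description precedes it below -/
import Mathlib

section
/- Every numerical monoid Γ with embedding dimension 5 and multiplicity 11 satisfies ρ(Γ) < 14. (Since 𝒞(4,11) = 14, this says 𝒭(4,11) < 𝒞(4,11).) -/
open scoped Pointwise

/-- A numerical monoid: an additive submonoid of ℕ with finite complement. -/
def IsNumericalMonoid (Γ : AddSubmonoid ℕ) : Prop :=
  ((Γ : Set ℕ)ᶜ).Finite

/-- The (unique) minimal generating set of a submonoid of ℕ: the nonzero elements
that are not sums of two nonzero elements. -/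
def minGens (Γ : AddSubmonoid ℕ) : Set ℕ :=
  {g | g ∈ Γ ∧ g ≠ 0 ∧ ∀ a ∈ Γ, ∀ b ∈ Γ, a ≠ 0 → b ≠ 0 → g ≠ a + b}

/-- Embedding dimension: the number of minimal generators. -/
noncomputable def edim (Γ : AddSubmonoid ℕ) : ℕ :=
  (minGens Γ).ncard

/-- Multiplicity: the smallest nonzero element. -/
noncomputable def mult (Γ : AddSubmonoid ℕ) : ℕ :=
  sInf {g : ℕ | g ∈ Γ ∧ g ≠ 0}

/-- The factorization homomorphism φ, sending a formal ℕ-combination of the minimal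
generators to its value in ℕ. -/
noncomputable def factorizationHom (Γ : AddSubmonoid ℕ) : (minGens Γ →₀ ℕ) →+ ℕ :=
  Finsupp.liftAddHom fun g => AddMonoidHom.mulLeft (g : ℕ)

/-- The number of minimal relations ρ(Γ): the least cardinality of a set of pairs
generating the kernel congruence of the factorization homomorphism. -/
noncomputable def rho (Γ : AddSubmonoid ℕ) : ℕ :=
  sInf {n : ℕ | ∃ R : Set ((minGens Γ →₀ ℕ) × (minGens Γ →₀ ℕ)),
    R.Finite ∧ R.ncard = n ∧
    addConGen (fun a b => (a, b) ∈ R) = AddCon.ker (factorizationHom Γ)}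

/-- Pseudo-Frobenius numbers of Γ. -/
def pseudoFrobenius (Γ : AddSubmonoid ℕ) : Set ℕ :=
  {p | p ∉ Γ ∧ ∀ g ∈ Γ, g ≠ 0 → p + g ∈ Γ}

/-- The type of Γ: the number of pseudo-Frobenius numbers. -/
noncomputable def numType (Γ : AddSubmonoid ℕ) : ℕ :=
  (pseudoFrobenius Γ).ncard

/-- The Apéry set of Γ with respect to its multiplicity. -/
def aperySet (Γ : AddSubmonoid ℕ) : Set ℕ :=
  {g | g ∈ Γ ∧ ¬ ∃ γ ∈ Γ, g = γ + mult Γ}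

/-- The Macaulay upper function: if `n = C(n_d,d) + ⋯ + C(n_j,j)` is the Macaulay
expansion of `n`, then `macUpper d n = C(n_d+1,d+1) + ⋯ + C(n_j+1,j+1)`, i.e. `n^⟨d⟩`. -/
noncomputable def macUpper : ℕ → ℕ → ℕ
  | 0, _ => 0
  | d + 1, n =>
    if n = 0 then 0
    else
      Nat.choose (sSup {a : ℕ | Nat.choose a (d + 1) ≤ n} + 1) (d + 2) +
        macUpper d (n - Nat.choose (sSup {a : ℕ | Nat.choose a (d + 1) ≤ n}) (d + 1))

/-- The Macaulay lower function: if `n = C(n_d,d) + ⋯ + C(n_j,j)` is the Macaulay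
expansion of `n`, then `macLower d n = C(n_d-1,d) + ⋯ + C(n_j-1,j)`, i.e. `n_⟨d⟩`. -/
noncomputable def macLower : ℕ → ℕ → ℕ
  | 0, _ => 0
  | d + 1, n =>
    if n = 0 then 0
    else
      Nat.choose (sSup {a : ℕ | Nat.choose a (d + 1) ≤ n} - 1) (d + 1) +
        macLower d (n - Nat.choose (sSup {a : ℕ | Nat.choose a (d + 1) ≤ n}) (d + 1))

/-- The unique positive `r` with `C(e+r-1,r-1) ≤ m < C(e+r,r)`. -/
noncomputable def macR (e m : ℕ) : ℕ :=
  sInf {r : ℕ | 0 < r ∧ m < Nat.choose (e + r) r}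

/-- The bound 𝒞(e,m) = C(e+r-1,r) + s^⟨r⟩ - s, where s = m - C(e+r-1,r-1). -/
noncomputable def mathcalC (e m : ℕ) : ℕ :=
  Nat.choose (e + macR e m - 1) (macR e m) +
      macUpper (macR e m) (m - Nat.choose (e + macR e m - 1) (macR e m - 1)) -
    (m - Nat.choose (e + macR e m - 1) (macR e m - 1))

/-- The bound 𝒟(e,m) = C(e+r-2,r-1) + s_⟨r⟩, where s = m - C(e+r-1,r-1). -/
noncomputable def mathcalD (e m : ℕ) : ℕ :=
  Nat.choose (e + macR e m - 2) (macR e m - 1) +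
    macLower (macR e m) (m - Nat.choose (e + macR e m - 1) (macR e m - 1))

/-- The exponent vectors of total degree at least two that can be the truncation of a corner. -/
def cornerCodes : List (Fin 4 → ℕ) :=
  [![2,0,0,0], ![0,2,0,0], ![0,0,2,0], ![0,0,0,2],
   ![1,1,0,0], ![1,0,1,0], ![1,0,0,1], ![0,1,1,0], ![0,1,0,1], ![0,0,1,1],
   ![2,1,0,0], ![1,2,0,0], ![2,0,1,0], ![1,0,2,0], ![2,0,0,1], ![1,0,0,2],
   ![0,2,1,0], ![0,1,2,0], ![0,2,0,1], ![0,1,0,2], ![0,0,2,1], ![0,0,1,2],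
   ![1,1,1,0], ![1,1,0,1], ![1,0,1,1], ![0,1,1,1],
   ![2,2,0,0], ![2,0,2,0], ![2,0,0,2], ![0,2,2,0], ![0,2,0,2], ![0,0,2,2]]

/-- The monomials of degree at most three that are not squarefree of degree three, nor cubes. -/
def smallMonomials : List (Fin 4 → ℕ) :=
  [![0,0,0,0], ![1,0,0,0], ![0,1,0,0], ![0,0,1,0], ![0,0,0,1],
   ![2,0,0,0], ![0,2,0,0], ![0,0,2,0], ![0,0,0,2],
   ![1,1,0,0], ![1,0,1,0], ![1,0,0,1], ![0,1,1,0], ![0,1,0,1], ![0,0,1,1],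
   ![2,1,0,0], ![1,2,0,0], ![2,0,1,0], ![1,0,2,0], ![2,0,0,1], ![1,0,0,2],
   ![0,2,1,0], ![0,1,2,0], ![0,2,0,1], ![0,1,0,2], ![0,0,2,1], ![0,0,1,2]]

theorem nodup_cornerCodes : cornerCodes.Nodup := by decide +kernel

theorem nodup_smallMonomials : smallMonomials.Nodup := by decide +kernel

theorem cornerCodes_or_large : ∀ c : Fin 4 → Fin 3,
    (fun i => (c i : ℕ)) ∈ cornerCodes ∨ c = 0 ∨ (∃ i, c = Pi.single i 1) ∨
      12 ≤ (Finset.univ.filter (fun u : Fin 4 → Fin 3 => ((∀ i, u i ≤ c i) ∧ u ≠ c) ∨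
        ∃ i, u = Pi.single i 1)).card := by
  decide +kernel

theorem cornerCodes_shape : ∀ c ∈ cornerCodes, (∃ i, ∀ j, j ≠ i → c j < 2) ∨
    ∃ i j, i ≠ j ∧ c = Pi.single i 2 + Pi.single j 2 := by
  decide +kernel

theorem not_sidon_zmod_eleven : ∀ a b c : ZMod 11,
    ¬ [0, a, b, c, a + a, b + b, c + c, a + b, a + c, b + c].Nodup := by
  decide +kernel

set_option synthInstance.maxSize 2000 in
set_option synthInstance.maxHeartbeats 400000 in
theorem bool_count : ∀ s0 s1 s2 s3 a b c d e f : Bool,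
    s0.toNat + s1.toNat + s2.toNat + s3.toNat + (a.toNat + b.toNat + c.toNat + d.toNat +
      e.toNat + f.toNat) ≤ 6 →
    ¬ (s1 ∧ s2 ∧ s3 ∧ d ∧ e ∧ f) → ¬ (s0 ∧ s2 ∧ s3 ∧ b ∧ c ∧ f) →
    ¬ (s0 ∧ s1 ∧ s3 ∧ a ∧ c ∧ e) → ¬ (s0 ∧ s1 ∧ s2 ∧ a ∧ b ∧ d) →
    ∀ N, N = ((!a).toNat + (!b).toNat + (!c).toNat + (!d).toNat + (!e).toNat + (!f).toNat) +
      ((s0 && a).toNat + (s1 && a).toNat + (s0 && b).toNat + (s2 && b).toNat +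
       (s0 && c).toNat + (s3 && c).toNat + (s1 && d).toNat + (s2 && d).toNat +
       (s1 && e).toNat + (s3 && e).toNat + (s2 && f).toNat + (s3 && f).toNat) +
      ((a && b && d).toNat + (a && c && e).toNat + (b && c && f).toNat + (d && e && f).toNat) →
    N ≤ 9 ∧ (s0.toNat + s1.toNat + s2.toNat + s3.toNat + (a.toNat + b.toNat + c.toNat + d.toNat +
      e.toNat + f.toNat) ≤ 4 → N ≤ 8) := by
  simp only [forall_eq]
  decide +kernel

theorem sum_toNat_decide_eq_card {α : Type*} [DecidableEq α] (P : α → Prop) [DecidablePred P]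
    {l : List α} (hl : l.Nodup) :
    (l.map fun c => (decide (P c)).toNat).sum = (l.toFinset.filter P).card := by
  rw [Finset.card_filter, ← List.sum_toFinset _ hl]
  refine Finset.sum_congr rfl fun c _ => ?_
  by_cases h : P c <;> simp [h]

theorem toNat_decide_le {P : Prop} [Decidable P] {b : Bool} (h : P → b = true) :
    (decide P).toNat ≤ b.toNat := by
  by_cases hP : P
  · simp [hP, h hP]
  · simp [hP]

theorem double_count
    (s0 s1 s2 s3 a b c d e f c01 c10 c02 c20 c03 c30 c12 c21 c13 c31 c23 c32 q0 q1 q2 q3 q4 q5 : ℕ)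
    (h : s0 + s1 + s2 + s3 + (a + b + c + d + e + f) +
      (c01 + c10 + c02 + c20 + c03 + c30 + c12 + c21 +
        c13 + c31 + c23 + c32) ≤ 6)
    (h0 : q0 ≤ c01 ∧ q0 ≤ c10 ∧ q0 ≤ s0 ∧ q0 ≤ s1 ∧ q0 ≤ a)
    (h1 : q1 ≤ c02 ∧ q1 ≤ c20 ∧ q1 ≤ s0 ∧ q1 ≤ s2 ∧ q1 ≤ b)
    (h2 : q2 ≤ c03 ∧ q2 ≤ c30 ∧ q2 ≤ s0 ∧ q2 ≤ s3 ∧ q2 ≤ c)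
    (h3 : q3 ≤ c12 ∧ q3 ≤ c21 ∧ q3 ≤ s1 ∧ q3 ≤ s2 ∧ q3 ≤ d)
    (h4 : q4 ≤ c13 ∧ q4 ≤ c31 ∧ q4 ≤ s1 ∧ q4 ≤ s3 ∧ q4 ≤ e)
    (h5 : q5 ≤ c23 ∧ q5 ≤ c32 ∧ q5 ≤ s2 ∧ q5 ≤ s3 ∧ q5 ≤ f) :
    s0 + s1 + s2 + s3 + (a + b + c + d + e + f) ≤ 6 ∧ (q0 + q1 + q2 + q3 + q4 + q5 = 0 ∨
      q0 + q1 + q2 + q3 + q4 + q5 = 1 ∧ s0 + s1 + s2 + s3 + (a + b + c + d + e + f) ≤ 4) := by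
  have hc : 2 * (q0 + q1 + q2 + q3 + q4 + q5) ≤
      c01 + c10 + c02 + c20 + c03 + c30 + c12 + c21 + c13 + c31 + c23 + c32 := by
    linarith
  have he : q0 + q1 + q2 + q3 + q4 + q5 ≤ a + b + c + d + e + f := by linarith
  refine ⟨by linarith, ?_⟩
  rcases Nat.eq_zero_or_pos (q0 + q1 + q2 + q3 + q4 + q5) with hq | hq
  · exact .inl hq
  right
  have hs : 2 ≤ s0 + s1 + s2 + s3 := by
    simp only [Nat.add_pos_iff_pos_or_pos] at hq
    rcases hq with ((((hq | hq) | hq) | hq) | hq) | hq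
    · linarith [h0.2.2.1, h0.2.2.2.1]
    · linarith [h1.2.2.1, h1.2.2.2.1]
    · linarith [h2.2.2.1, h2.2.2.2.1]
    · linarith [h3.2.2.1, h3.2.2.2.1]
    · linarith [h4.2.2.1, h4.2.2.2.1]
    · linarith [h5.2.2.1, h5.2.2.2.1]
  clear h0 h1 h2 h3 h4 h5
  generalize q0 + q1 + q2 + q3 + q4 + q5 = Q at *
  generalize a + b + c + d + e + f = E at *
  generalize s0 + s1 + s2 + s3 = S at *
  omega

/-- Truncate every exponent at two. -/
def trunc (m : Fin 4 → ℕ) : Fin 4 → ℕ := fun i => min (m i) 2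

theorem trunc_le (m : Fin 4 → ℕ) : trunc m ≤ m := fun _ => min_le_left _ _

section Corners

variable {B : Set (Fin 4 → ℕ)} (hB : IsLowerSet B) (r : (Fin 4 → ℕ) →+ ZMod 11)
  (hr : Set.InjOn r B) (hX : ∀ i, Pi.single i 1 ∈ B)

include hr in
theorem card_le_eleven {T : Finset (Fin 4 → ℕ)} (hT : ∀ u ∈ T, u ∈ B) : T.card ≤ 11 := by
  have := Finset.card_le_card_of_injOn (t := (Finset.univ : Finset (ZMod 11))) r
    (fun _ _ => Finset.mem_coe.2 (Finset.mem_univ _)) (hr.mono hT)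
  simpa using this

theorem mem_of_lt_minimal {m u : Fin 4 → ℕ} (hm : Minimal (· ∉ B) m) (h : u < m) : u ∈ B := by
  by_contra hu
  exact hm.not_prop_of_lt h hu

theorem minimal_eq_of_le {m m' : Fin 4 → ℕ} (hm : Minimal (· ∉ B) m) (hm' : Minimal (· ∉ B) m')
    (h : m ≤ m') : m = m' :=
  le_antisymm h (hm'.le_of_le hm.prop h)

include hB hr hX in
theorem trunc_mem_cornerCodes {m : Fin 4 → ℕ} (hm : Minimal (· ∉ B) m) :
    trunc m ∈ cornerCodes := by
  have h0 : (0 : Fin 4 → ℕ) ∈ B := hB (fun i => Nat.zero_le _) (hX 0)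
  let c : Fin 4 → Fin 3 := fun i => ⟨min (m i) 2, by omega⟩
  rcases cornerCodes_or_large c with h | h | ⟨i, h⟩ | h
  · exact h
  · refine absurd h0 ?_
    have : m = 0 := by
      funext i
      have := congrArg Fin.val (congrFun h i)
      simp [c] at this
      simpa using this
    exact this ▸ hm.prop
  · refine absurd (hX i) ?_
    have : m = Pi.single i 1 := by
      funext j
      have := congrArg Fin.val (congrFun h j)
      rcases eq_or_ne j i with rfl | hj
      · simp [c] at this ⊢; omega
      · simp [c, hj] at this ⊢; omega
    exact this ▸ hm.prop
  · exfalso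
    let f : (Fin 4 → Fin 3) → (Fin 4 → ℕ) := fun u i => (u i : ℕ)
    have hf : Function.Injective f := fun u v huv => by
      funext i
      exact Fin.ext (congrFun huv i)
    have := card_le_eleven r hr (T := (Finset.univ.filter (fun u : Fin 4 → Fin 3 =>
      ((∀ i, u i ≤ c i) ∧ u ≠ c) ∨ ∃ i, u = Pi.single i 1)).image f) ?_
    · rw [Finset.card_image_of_injective _ hf] at this
      omega
    · intro u hu
      obtain ⟨v, hv, rfl⟩ := Finset.mem_image.1 hu
      rcases (Finset.mem_filter.1 hv).2 with ⟨hle, hne⟩ | ⟨i, rfl⟩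
      · refine mem_of_lt_minimal hm (lt_of_lt_of_le (lt_of_le_of_ne (fun i => hle i) ?_)
          (trunc_le m))
        exact fun h => hne (hf h)
      · convert hX i using 1
        funext j
        rcases eq_or_ne j i with rfl | hj
        · simp [f]
        · simp [f, hj]

theorem card_double_box : ∀ i j : Fin 4, i ≠ j →
    ({0, Pi.single 0 1, Pi.single 1 1, Pi.single 2 1, Pi.single 3 1, Pi.single i 2, Pi.single j 2,
      Pi.single i 1 + Pi.single j 1, Pi.single i 2 + Pi.single j 1, Pi.single i 1 + Pi.single j 2,
      Pi.single i 2 + Pi.single j 2, Pi.single i 3} : Finset (Fin 4 → ℕ)).card = 12 := by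
  decide +kernel

include hB hr hX in
theorem minimal_apply_le_two {m : Fin 4 → ℕ} (hm : Minimal (· ∉ B) m) {i j : Fin 4} (hij : i ≠ j)
    (hi : 2 ≤ m i) (hj : 2 ≤ m j) : m i ≤ 2 := by
  by_contra! h3
  have h0 : (0 : Fin 4 → ℕ) ∈ B := hB (fun i => Nat.zero_le _) (hX 0)
  have key (a b : ℕ) (ha : a ≤ 3) (hb : b ≤ 2) (hab : a ≤ 2 ∨ b ≤ 1) :
      (Pi.single i a + Pi.single j b : Fin 4 → ℕ) ∈ B := by
    refine mem_of_lt_minimal hm (lt_of_le_of_ne (fun k => ?_) fun h => ?_)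
    · rcases eq_or_ne k i with rfl | hk
      · simp [hij]; omega
      · rcases eq_or_ne k j with rfl | hk'
        · simp [hk]; omega
        · simp [hk, hk']
    · have h1 := congrFun h i
      have h2 := congrFun h j
      simp [hij, hij.symm] at h1 h2
      omega
  have := card_le_eleven r hr (T := {0, Pi.single 0 1, Pi.single 1 1, Pi.single 2 1, Pi.single 3 1,
      Pi.single i 2, Pi.single j 2,
      Pi.single i 1 + Pi.single j 1, Pi.single i 2 + Pi.single j 1, Pi.single i 1 + Pi.single j 2,
      Pi.single i 2 + Pi.single j 2, Pi.single i 3}) ?_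
  · rw [card_double_box i j hij] at this
    omega
  · intro u hu
    simp only [Finset.mem_insert, Finset.mem_singleton] at hu
    rcases hu with rfl | rfl | rfl | rfl | rfl | rfl | rfl | rfl | rfl | rfl | rfl | rfl
    · exact h0
    · exact hX 0
    · exact hX 1
    · exact hX 2
    · exact hX 3
    · simpa using key 2 0 (by simp) (by simp) (by simp)
    · simpa using key 0 2 (by simp) (by simp) (by simp)
    · exact key 1 1 (by simp) (by simp) (by simp)
    · exact key 2 1 (by simp) (by simp) (by simp)
    · exact key 1 2 (by simp) (by simp) (by simp)
    · exact key 2 2 (by simp) (by simp) (by simp)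
    · simpa using key 3 0 (by simp) (by simp) (by simp)

include hB hr hX in
theorem injOn_trunc : Set.InjOn trunc {m | Minimal (· ∉ B) m} := by
  intro m hm m' hm' h
  have hmm : ∀ k, min (m k) 2 = min (m' k) 2 := fun k => congrFun h k
  rcases cornerCodes_shape _ (trunc_mem_cornerCodes hB r hr hX hm) with ⟨i, hi⟩ | ⟨i, j, hij, hc⟩
  · have heq : ∀ j, j ≠ i → m j = m' j := fun j hj => by
      have h1 : min (m j) 2 < 2 := hi j hj
      have h2 := hmm j
      omega
    have of_le : ∀ {a b : Fin 4 → ℕ}, (∀ j, j ≠ i → a j = b j) → a i ≤ b i → a ≤ b :=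
      fun {a b} hab hle j => by
        rcases eq_or_ne j i with rfl | hj
        · exact hle
        · exact (hab j hj).le
    rcases le_total (m i) (m' i) with hle | hle
    · exact minimal_eq_of_le hm hm' (of_le heq hle)
    · exact (minimal_eq_of_le hm' hm (of_le (fun j hj => (heq j hj).symm) hle)).symm
  · have hck : ∀ k, min (m k) 2 = (Pi.single i 2 + Pi.single j 2 : Fin 4 → ℕ) k :=
      fun k => congrFun hc k
    have mi : min (m i) 2 = 2 := by simpa [hij] using hck i
    have mj : min (m j) 2 = 2 := by simpa [hij.symm] using hck j
    have mi' := hmm i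
    have mj' := hmm j
    have h1 := minimal_apply_le_two hB r hr hX hm hij (by omega) (by omega)
    have h2 := minimal_apply_le_two hB r hr hX hm hij.symm (by omega) (by omega)
    have h3 := minimal_apply_le_two hB r hr hX hm' hij (by omega) (by omega)
    have h4 := minimal_apply_le_two hB r hr hX hm' hij.symm (by omega) (by omega)
    funext k
    rcases eq_or_ne k i with rfl | hk
    · omega
    · rcases eq_or_ne k j with rfl | hk'
      · omega
      · have h5 := hck k
        simp [hk, hk'] at h5
        have h6 := hmm k
        omega

include hr in
theorem not_all_quadrics_mem (i j k : Fin 4)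
    (hn : [0, Pi.single i 1, Pi.single j 1, Pi.single k 1, Pi.single i 1 + Pi.single i 1,
      Pi.single j 1 + Pi.single j 1, Pi.single k 1 + Pi.single k 1, Pi.single i 1 + Pi.single j 1,
      Pi.single i 1 + Pi.single k 1, (Pi.single j 1 + Pi.single k 1 : Fin 4 → ℕ)].Nodup)
    (h : ∀ u ∈ [0, Pi.single i 1, Pi.single j 1, Pi.single k 1, Pi.single i 1 + Pi.single i 1,
      Pi.single j 1 + Pi.single j 1, Pi.single k 1 + Pi.single k 1, Pi.single i 1 + Pi.single j 1,
      Pi.single i 1 + Pi.single k 1, (Pi.single j 1 + Pi.single k 1 : Fin 4 → ℕ)], u ∈ B) :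
    False := by
  refine not_sidon_zmod_eleven (r (Pi.single i 1)) (r (Pi.single j 1)) (r (Pi.single k 1)) ?_
  have := hn.map_on (f := r) fun x hx y hy hxy => hr (h x hx) (h y hy) hxy
  simpa only [List.map, map_add, map_zero] using this

set_option maxHeartbeats 1000000 in
include hB hr hX in
theorem minimal_compl_finite_and_ncard_le :
    {m | Minimal (· ∉ B) m}.Finite ∧ {m | Minimal (· ∉ B) m}.ncard ≤ 13 := by
  classical
  let A : (Fin 4 → ℕ) → Prop := fun c => ∃ m, Minimal (· ∉ B) m ∧ trunc m = c
  have maps : ∀ m ∈ {m | Minimal (· ∉ B) m}, trunc m ∈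
      ((cornerCodes.toFinset.filter A : Finset (Fin 4 → ℕ)) : Set (Fin 4 → ℕ)) := fun m hm =>
    Finset.mem_coe.2 (Finset.mem_filter.2
      ⟨List.mem_toFinset.2 (trunc_mem_cornerCodes hB r hr hX hm), m, hm, rfl⟩)
  have inj := injOn_trunc hB r hr hX
  refine ⟨Set.Finite.of_injOn maps inj (Finset.finite_toSet _), ?_⟩
  have hcard := Set.ncard_le_ncard_of_injOn trunc maps inj (Finset.finite_toSet _)
  rw [Set.ncard_coe_finset, ← sum_toNat_decide_eq_card A nodup_cornerCodes] at hcard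
  refine hcard.trans ?_
  clear hcard
  have hsmall := card_le_eleven r hr (T := smallMonomials.toFinset.filter (· ∈ B))
    (fun u hu => (Finset.mem_filter.1 hu).2)
  rw [← sum_toNat_decide_eq_card (· ∈ B) nodup_smallMonomials] at hsmall
  have h1 (c u : Fin 4 → ℕ) (h : (∀ i, u i ≤ c i) ∧ u ≠ c) (hc : A c) : u ∈ B := by
    obtain ⟨m, hm, rfl⟩ := hc
    exact mem_of_lt_minimal hm (lt_of_lt_of_le (lt_of_le_of_ne h.1 h.2) (trunc_le m))
  have hA1 (c u : Fin 4 → ℕ) (h : (∀ i, u i ≤ c i) ∧ u ≠ c) (hc : A c) : decide (u ∈ B) = true :=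
    decide_eq_true (h1 c u h hc)
  have hA2 (c u v : Fin 4 → ℕ) (hu : (∀ i, u i ≤ c i) ∧ u ≠ c)
      (hv : (∀ i, v i ≤ c i) ∧ v ≠ c) (hc : A c) :
      (decide (u ∈ B) && decide (v ∈ B)) = true := by
    rw [hA1 c u hu hc, hA1 c v hv hc]; rfl
  have hA3 (c u v w : Fin 4 → ℕ) (hu : (∀ i, u i ≤ c i) ∧ u ≠ c)
      (hv : (∀ i, v i ≤ c i) ∧ v ≠ c) (hw : (∀ i, w i ≤ c i) ∧ w ≠ c)
      (hc : A c) : (decide (u ∈ B) && decide (v ∈ B) && decide (w ∈ B)) = true := by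
    rw [hA1 c u hu hc, hA1 c v hv hc, hA1 c w hw hc]; rfl
  have hE (c : Fin 4 → ℕ) (h : ∀ i, c i < 2) (hc : A c) : (!decide (c ∈ B)) = true := by
    obtain ⟨m, hm, rfl⟩ := hc
    have : trunc m = m := by
      funext i
      have h' : min (m i) 2 < 2 := h i
      change min (m i) 2 = m i
      omega
    rw [this]
    simpa using hm.prop
  have hX' (v : Fin 4 → ℕ) (h : ∃ i, ∀ j, v j ≤ (Pi.single i 1 : Fin 4 → ℕ) j) :
      (decide (v ∈ B)).toNat = 1 := by
    obtain ⟨i, hi⟩ := h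
    simp [hB hi (hX i)]
  have x := hX' ![0,0,0,0] (by decide +kernel)
  have x0 := hX' ![1,0,0,0] (by decide +kernel)
  have x1 := hX' ![0,1,0,0] (by decide +kernel)
  have x2 := hX' ![0,0,1,0] (by decide +kernel)
  have x3 := hX' ![0,0,0,1] (by decide +kernel)
  have sidon (i j k : Fin 4) (l : List (Fin 4 → ℕ)) (hl : l = [Pi.single i 1 + Pi.single i 1,
      Pi.single j 1 + Pi.single j 1, Pi.single k 1 + Pi.single k 1, Pi.single i 1 + Pi.single j 1,
      Pi.single i 1 + Pi.single k 1, Pi.single j 1 + Pi.single k 1])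
      (hn : (0 :: Pi.single i 1 :: Pi.single j 1 :: Pi.single k 1 :: l).Nodup)
      (h : ∀ u ∈ l, decide (u ∈ B) = true) : False := by
    subst hl
    refine not_all_quadrics_mem r hr i j k hn ?_
    simp only [List.forall_mem_cons]
    simp only [List.forall_mem_cons, decide_eq_true_eq] at h
    exact ⟨hB (fun i => Nat.zero_le _) (hX 0), hX i, hX j, hX k, h⟩
  simp only [smallMonomials, List.map, List.sum_cons, List.sum_nil, x, x0, x1, x2, x3] at hsmall
  clear x x0 x1 x2 x3
  have n0 := sidon 1 2 3 [![0,2,0,0], ![0,0,2,0], ![0,0,0,2], ![0,1,1,0], ![0,1,0,1], ![0,0,1,1]]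
    (by decide +kernel) (by decide +kernel)
  have n1 := sidon 0 2 3 [![2,0,0,0], ![0,0,2,0], ![0,0,0,2], ![1,0,1,0], ![1,0,0,1], ![0,0,1,1]]
    (by decide +kernel) (by decide +kernel)
  have n2 := sidon 0 1 3 [![2,0,0,0], ![0,2,0,0], ![0,0,0,2], ![1,1,0,0], ![1,0,0,1], ![0,1,0,1]]
    (by decide +kernel) (by decide +kernel)
  have n3 := sidon 0 1 2 [![2,0,0,0], ![0,2,0,0], ![0,0,2,0], ![1,1,0,0], ![1,0,1,0], ![0,1,1,0]]
    (by decide +kernel) (by decide +kernel)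
  simp only [List.forall_mem_cons] at n0 n1 n2 n3
  have p0 : (decide (A ![2,0,0,0])).toNat ≤ 1 := Bool.toNat_le _
  have p1 : (decide (A ![0,2,0,0])).toNat ≤ 1 := Bool.toNat_le _
  have p2 : (decide (A ![0,0,2,0])).toNat ≤ 1 := Bool.toNat_le _
  have p3 : (decide (A ![0,0,0,2])).toNat ≤ 1 := Bool.toNat_le _
  have e01 := toNat_decide_le (hE ![1,1,0,0] (by decide))
  have e02 := toNat_decide_le (hE ![1,0,1,0] (by decide))
  have e03 := toNat_decide_le (hE ![1,0,0,1] (by decide))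
  have e12 := toNat_decide_le (hE ![0,1,1,0] (by decide))
  have e13 := toNat_decide_le (hE ![0,1,0,1] (by decide))
  have e23 := toNat_decide_le (hE ![0,0,1,1] (by decide))
  have o01 := toNat_decide_le (hA2 ![2,1,0,0] ![2,0,0,0] ![1,1,0,0]
    (by decide +kernel) (by decide +kernel))
  have o02 := toNat_decide_le (hA2 ![2,0,1,0] ![2,0,0,0] ![1,0,1,0]
    (by decide +kernel) (by decide +kernel))
  have o03 := toNat_decide_le (hA2 ![2,0,0,1] ![2,0,0,0] ![1,0,0,1]
    (by decide +kernel) (by decide +kernel))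
  have o10 := toNat_decide_le (hA2 ![1,2,0,0] ![0,2,0,0] ![1,1,0,0]
    (by decide +kernel) (by decide +kernel))
  have o12 := toNat_decide_le (hA2 ![0,2,1,0] ![0,2,0,0] ![0,1,1,0]
    (by decide +kernel) (by decide +kernel))
  have o13 := toNat_decide_le (hA2 ![0,2,0,1] ![0,2,0,0] ![0,1,0,1]
    (by decide +kernel) (by decide +kernel))
  have o20 := toNat_decide_le (hA2 ![1,0,2,0] ![0,0,2,0] ![1,0,1,0]
    (by decide +kernel) (by decide +kernel))
  have o21 := toNat_decide_le (hA2 ![0,1,2,0] ![0,0,2,0] ![0,1,1,0]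
    (by decide +kernel) (by decide +kernel))
  have o23 := toNat_decide_le (hA2 ![0,0,2,1] ![0,0,2,0] ![0,0,1,1]
    (by decide +kernel) (by decide +kernel))
  have o30 := toNat_decide_le (hA2 ![1,0,0,2] ![0,0,0,2] ![1,0,0,1]
    (by decide +kernel) (by decide +kernel))
  have o31 := toNat_decide_le (hA2 ![0,1,0,2] ![0,0,0,2] ![0,1,0,1]
    (by decide +kernel) (by decide +kernel))
  have o32 := toNat_decide_le (hA2 ![0,0,1,2] ![0,0,0,2] ![0,0,1,1]
    (by decide +kernel) (by decide +kernel))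
  have t012 := toNat_decide_le (hA3 ![1,1,1,0] ![1,1,0,0] ![1,0,1,0] ![0,1,1,0]
    (by decide +kernel) (by decide +kernel) (by decide +kernel))
  have t013 := toNat_decide_le (hA3 ![1,1,0,1] ![1,1,0,0] ![1,0,0,1] ![0,1,0,1]
    (by decide +kernel) (by decide +kernel) (by decide +kernel))
  have t023 := toNat_decide_le (hA3 ![1,0,1,1] ![1,0,1,0] ![1,0,0,1] ![0,0,1,1]
    (by decide +kernel) (by decide +kernel) (by decide +kernel))
  have t123 := toNat_decide_le (hA3 ![0,1,1,1] ![0,1,1,0] ![0,1,0,1] ![0,0,1,1]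
    (by decide +kernel) (by decide +kernel) (by decide +kernel))
  have q010 := toNat_decide_le (hA1 ![2,2,0,0] ![2,1,0,0] (by decide +kernel))
  have q011 := toNat_decide_le (hA1 ![2,2,0,0] ![1,2,0,0] (by decide +kernel))
  have q012 := toNat_decide_le (hA1 ![2,2,0,0] ![2,0,0,0] (by decide +kernel))
  have q013 := toNat_decide_le (hA1 ![2,2,0,0] ![0,2,0,0] (by decide +kernel))
  have q014 := toNat_decide_le (hA1 ![2,2,0,0] ![1,1,0,0] (by decide +kernel))
  have q020 := toNat_decide_le (hA1 ![2,0,2,0] ![2,0,1,0] (by decide +kernel))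
  have q021 := toNat_decide_le (hA1 ![2,0,2,0] ![1,0,2,0] (by decide +kernel))
  have q022 := toNat_decide_le (hA1 ![2,0,2,0] ![2,0,0,0] (by decide +kernel))
  have q023 := toNat_decide_le (hA1 ![2,0,2,0] ![0,0,2,0] (by decide +kernel))
  have q024 := toNat_decide_le (hA1 ![2,0,2,0] ![1,0,1,0] (by decide +kernel))
  have q030 := toNat_decide_le (hA1 ![2,0,0,2] ![2,0,0,1] (by decide +kernel))
  have q031 := toNat_decide_le (hA1 ![2,0,0,2] ![1,0,0,2] (by decide +kernel))
  have q032 := toNat_decide_le (hA1 ![2,0,0,2] ![2,0,0,0] (by decide +kernel))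
  have q033 := toNat_decide_le (hA1 ![2,0,0,2] ![0,0,0,2] (by decide +kernel))
  have q034 := toNat_decide_le (hA1 ![2,0,0,2] ![1,0,0,1] (by decide +kernel))
  have q120 := toNat_decide_le (hA1 ![0,2,2,0] ![0,2,1,0] (by decide +kernel))
  have q121 := toNat_decide_le (hA1 ![0,2,2,0] ![0,1,2,0] (by decide +kernel))
  have q122 := toNat_decide_le (hA1 ![0,2,2,0] ![0,2,0,0] (by decide +kernel))
  have q123 := toNat_decide_le (hA1 ![0,2,2,0] ![0,0,2,0] (by decide +kernel))
  have q124 := toNat_decide_le (hA1 ![0,2,2,0] ![0,1,1,0] (by decide +kernel))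
  have q130 := toNat_decide_le (hA1 ![0,2,0,2] ![0,2,0,1] (by decide +kernel))
  have q131 := toNat_decide_le (hA1 ![0,2,0,2] ![0,1,0,2] (by decide +kernel))
  have q132 := toNat_decide_le (hA1 ![0,2,0,2] ![0,2,0,0] (by decide +kernel))
  have q133 := toNat_decide_le (hA1 ![0,2,0,2] ![0,0,0,2] (by decide +kernel))
  have q134 := toNat_decide_le (hA1 ![0,2,0,2] ![0,1,0,1] (by decide +kernel))
  have q230 := toNat_decide_le (hA1 ![0,0,2,2] ![0,0,2,1] (by decide +kernel))
  have q231 := toNat_decide_le (hA1 ![0,0,2,2] ![0,0,1,2] (by decide +kernel))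
  have q232 := toNat_decide_le (hA1 ![0,0,2,2] ![0,0,2,0] (by decide +kernel))
  have q233 := toNat_decide_le (hA1 ![0,0,2,2] ![0,0,0,2] (by decide +kernel))
  have q234 := toNat_decide_le (hA1 ![0,0,2,2] ![0,0,1,1] (by decide +kernel))
  simp only [cornerCodes, List.map, List.sum_cons, List.sum_nil]
  clear sidon hA1 hA2 hA3 hE hX' h1 inj maps
  generalize decide (![2,0,0,0] ∈ B) = s0 at *
  generalize decide (![0,2,0,0] ∈ B) = s1 at *
  generalize decide (![0,0,2,0] ∈ B) = s2 at *
  generalize decide (![0,0,0,2] ∈ B) = s3 at *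
  generalize decide (![1,1,0,0] ∈ B) = a at *
  generalize decide (![1,0,1,0] ∈ B) = b at *
  generalize decide (![1,0,0,1] ∈ B) = c at *
  generalize decide (![0,1,1,0] ∈ B) = d at *
  generalize decide (![0,1,0,1] ∈ B) = e at *
  generalize decide (![0,0,1,1] ∈ B) = f at *
  generalize decide (![2,1,0,0] ∈ B) = c01 at *
  generalize decide (![2,0,1,0] ∈ B) = c02 at *
  generalize decide (![2,0,0,1] ∈ B) = c03 at *
  generalize decide (![1,2,0,0] ∈ B) = c10 at *
  generalize decide (![0,2,1,0] ∈ B) = c12 at *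
  generalize decide (![0,2,0,1] ∈ B) = c13 at *
  generalize decide (![1,0,2,0] ∈ B) = c20 at *
  generalize decide (![0,1,2,0] ∈ B) = c21 at *
  generalize decide (![0,0,2,1] ∈ B) = c23 at *
  generalize decide (![1,0,0,2] ∈ B) = c30 at *
  generalize decide (![0,1,0,2] ∈ B) = c31 at *
  generalize decide (![0,0,1,2] ∈ B) = c32 at *
  generalize (decide (A ![2,0,0,0])).toNat = y0 at *
  generalize (decide (A ![0,2,0,0])).toNat = y1 at *
  generalize (decide (A ![0,0,2,0])).toNat = y2 at *
  generalize (decide (A ![0,0,0,2])).toNat = y3 at *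
  generalize (decide (A ![1,1,0,0])).toNat = y4 at *
  generalize (decide (A ![1,0,1,0])).toNat = y5 at *
  generalize (decide (A ![1,0,0,1])).toNat = y6 at *
  generalize (decide (A ![0,1,1,0])).toNat = y7 at *
  generalize (decide (A ![0,1,0,1])).toNat = y8 at *
  generalize (decide (A ![0,0,1,1])).toNat = y9 at *
  generalize (decide (A ![2,1,0,0])).toNat = y10 at *
  generalize (decide (A ![1,2,0,0])).toNat = y11 at *
  generalize (decide (A ![2,0,1,0])).toNat = y12 at *
  generalize (decide (A ![1,0,2,0])).toNat = y13 at *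
  generalize (decide (A ![2,0,0,1])).toNat = y14 at *
  generalize (decide (A ![1,0,0,2])).toNat = y15 at *
  generalize (decide (A ![0,2,1,0])).toNat = y16 at *
  generalize (decide (A ![0,1,2,0])).toNat = y17 at *
  generalize (decide (A ![0,2,0,1])).toNat = y18 at *
  generalize (decide (A ![0,1,0,2])).toNat = y19 at *
  generalize (decide (A ![0,0,2,1])).toNat = y20 at *
  generalize (decide (A ![0,0,1,2])).toNat = y21 at *
  generalize (decide (A ![1,1,1,0])).toNat = y22 at *
  generalize (decide (A ![1,1,0,1])).toNat = y23 at *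
  generalize (decide (A ![1,0,1,1])).toNat = y24 at *
  generalize (decide (A ![0,1,1,1])).toNat = y25 at *
  generalize (decide (A ![2,2,0,0])).toNat = y26 at *
  generalize (decide (A ![2,0,2,0])).toNat = y27 at *
  generalize (decide (A ![2,0,0,2])).toNat = y28 at *
  generalize (decide (A ![0,2,2,0])).toNat = y29 at *
  generalize (decide (A ![0,2,0,2])).toNat = y30 at *
  generalize (decide (A ![0,0,2,2])).toNat = y31 at *
  have hQ := double_count s0.toNat s1.toNat s2.toNat s3.toNat a.toNat b.toNat c.toNat d.toNat
    e.toNat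
    f.toNat c01.toNat c10.toNat c02.toNat c20.toNat c03.toNat c30.toNat
    c12.toNat c21.toNat c13.toNat c31.toNat c23.toNat c32.toNat
    y26 y27 y28 y29 y30 y31 (by clear * - hsmall; linarith)
    ⟨q010, q011, q012, q013, q014⟩
    ⟨q020, q021, q022, q023, q024⟩
    ⟨q030, q031, q032, q033, q034⟩
    ⟨q120, q121, q122, q123, q124⟩
    ⟨q130, q131, q132, q133, q134⟩
    ⟨q230, q231, q232, q233, q234⟩
  obtain ⟨hSE, hQ⟩ := hQ
  have count := bool_count s0 s1 s2 s3 a b c d e f hSE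
    (fun ⟨h1, h2, h3, h4, h5, h6⟩ => n0 ⟨h1, h2, h3, h4, h5, h6, by simp⟩)
    (fun ⟨h1, h2, h3, h4, h5, h6⟩ => n1 ⟨h1, h2, h3, h4, h5, h6, by simp⟩)
    (fun ⟨h1, h2, h3, h4, h5, h6⟩ => n2 ⟨h1, h2, h3, h4, h5, h6, by simp⟩)
    (fun ⟨h1, h2, h3, h4, h5, h6⟩ => n3 ⟨h1, h2, h3, h4, h5, h6, by simp⟩)
    _ rfl
  obtain ⟨hN, hN'⟩ := count
  clear n0 n1 n2 n3 hsmall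
    q010 q011 q012 q013 q014 q020 q021 q022 q023 q024 q030 q031 q032 q033 q034
    q120 q121 q122 q123 q124 q130 q131 q132 q133 q134 q230 q231 q232 q233 q234
  rcases hQ with hQ | ⟨hQ, hle⟩
  · linarith
  · have := hN' hle
    linarith

end Corners

theorem exists_generators_of_ker {F : Type*} [AddCommMonoid F] (ψ : F →+ ℕ) (e₀ : F)
    (ι : (Fin 4 → ℕ) →+ F) (h₀ : ψ e₀ = 11) (hsurj : ∀ x, ∃ (a : ℕ) (m : _), x = a • e₀ + ι m)
    (hmin : ∀ i m, ψ (ι m) ≡ ψ (ι (Pi.single i 1)) [MOD 11] →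
      ψ (ι m) ≤ ψ (ι (Pi.single i 1)) → m = Pi.single i 1) :
    ∃ R : Set (F × F), R.Finite ∧ R.ncard ≤ 13 ∧
      addConGen (fun a b => (a, b) ∈ R) = AddCon.ker ψ := by
  let r : (Fin 4 → ℕ) →+ ZMod 11 := (Nat.castAddMonoidHom (ZMod 11)).comp (ψ.comp ι)
  have hr (m n) : r m = r n ↔ ψ (ι m) ≡ ψ (ι n) [MOD 11] := by
    simp only [r, AddMonoidHom.comp_apply, Nat.coe_castAddMonoidHom]
    exact ZMod.natCast_eq_natCast_iff _ _ _
  let key (m : Fin 4 → ℕ) : ℕ ×ₗ Lex (Fin 4 → ℕ) := toLex (ψ (ι m), toLex m)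
  have key_add (u v) : key (u + v) = key u + key v := by
    simp only [key, map_add]; rfl
  have key_inj : Function.Injective key := fun u v h =>
    congrArg (fun x : ℕ ×ₗ Lex (Fin 4 → ℕ) => (ofLex (ofLex x).2 : Fin 4 → ℕ)) h
  have key_le {u v} (h : key u ≤ key v) : ψ (ι u) ≤ ψ (ι v) := Prod.Lex.monotone_fst _ _ h
  let B : Set (Fin 4 → ℕ) := {m | ∀ n, r n = r m → key m ≤ key n}
  have hB : IsLowerSet B := by
    intro m u hum hm n hn
    obtain ⟨v, rfl⟩ := exists_add_of_le hum
    have := hm (n + v) (by rw [map_add, map_add, hn])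
    rw [key_add, key_add] at this
    exact le_of_add_le_add_right this
  have hinj : Set.InjOn r B := fun m hm n hn h =>
    key_inj (le_antisymm (hm n h.symm) (hn m h))
  have hX (i : Fin 4) : Pi.single i 1 ∈ B := by
    intro n hn
    by_contra! hlt
    have := hmin i n ((hr _ _).1 hn) (key_le hlt.le)
    exact hlt.ne (congrArg key this)
  have hnf (m) : ∃ n ∈ B, r n = r m := by
    obtain ⟨n, hn, hn'⟩ := (InvImage.wf key wellFounded_lt).has_min {n | r n = r m} ⟨m, rfl⟩
    exact ⟨n, fun k hk => not_lt.1 (hn' k (hk.trans hn)), hn⟩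
  choose nf hnfB hnfr using hnf
  have hval (m) : ψ (ι m) = (ψ (ι m) - ψ (ι (nf m))) / 11 * 11 + ψ (ι (nf m)) := by
    have h1 := key_le (hnfB m m (hnfr m).symm)
    have h2 := (Nat.modEq_iff_dvd' h1).1 ((hr _ _).1 (hnfr m))
    rw [Nat.div_mul_cancel h2]
    omega
  let rel (m) : F × F := (ι m, ((ψ (ι m) - ψ (ι (nf m))) / 11) • e₀ + ι (nf m))
  obtain ⟨hfin, hcard⟩ := minimal_compl_finite_and_ncard_le hB r hinj hX
  have hker : addConGen (fun a b => (a, b) ∈ rel '' {m | Minimal (· ∉ B) m}) ≤ AddCon.ker ψ := by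
    refine AddCon.addConGen_le.2 ?_
    rintro x y ⟨m, -, h⟩
    obtain ⟨rfl, rfl⟩ := Prod.mk.inj h
    rw [AddCon.ker_rel, map_add, map_nsmul, h₀, smul_eq_mul]
    exact hval m
  refine ⟨rel '' {m | Minimal (· ∉ B) m}, hfin.image _,
    (Set.ncard_image_le hfin).trans hcard, le_antisymm hker ?_⟩
  set c := addConGen (fun a b => (a, b) ∈ rel '' {m | Minimal (· ∉ B) m})
  have reduce (m) : ∀ n ∈ B, r n = r m → ∃ k : ℕ, c (ι m) (k • e₀ + ι n) := by
    induction m using (InvImage.wf key wellFounded_lt).induction with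
    | _ m ih =>
      intro n hn hnm
      by_cases hm : m ∈ B
      · obtain rfl := hinj hn hm hnm
        exact ⟨0, by simpa using c.refl _⟩
      · obtain ⟨p, hpm, hp⟩ := exists_minimal_le_of_wellFoundedLT (· ∉ B) m hm
        obtain ⟨v, rfl⟩ := exists_add_of_le hpm
        have hlt : key (nf p) < key p := lt_of_le_of_ne (hnfB p p (hnfr p).symm) fun h =>
          hp.prop (key_inj h ▸ hnfB p)
        obtain ⟨k, hk⟩ := ih (nf p + v)
          (by change key (nf p + v) < key (p + v)
              rw [key_add, key_add]; exact add_lt_add_left hlt _) n hn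
          (by rw [hnm, map_add, map_add, hnfr])
        have h1 : c (rel p).1 (rel p).2 := AddConGen.Rel.of _ _ ⟨p, hp, rfl⟩
        have h2 := c.add h1 (c.refl (ι v))
        have h3 := c.add (c.refl (((ψ (ι p) - ψ (ι (nf p))) / 11) • e₀)) hk
        refine ⟨(ψ (ι p) - ψ (ι (nf p))) / 11 + k, ?_⟩
        rw [map_add, add_smul, add_assoc]
        refine c.trans h2 ?_
        simpa only [rel, map_add, add_assoc] using h3
  intro x y hxy
  rw [AddCon.ker_rel] at hxy
  obtain ⟨a, m, rfl⟩ := hsurj x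
  obtain ⟨b, m', rfl⟩ := hsurj y
  simp only [map_add, map_nsmul, h₀, smul_eq_mul] at hxy
  have hmm : r m = r m' := by
    rw [hr]
    have := congrArg (· % 11) hxy
    simpa [Nat.add_mod, Nat.ModEq] using this
  obtain ⟨k, hk⟩ := reduce m (nf m) (hnfB m) (hnfr m)
  obtain ⟨k', hk'⟩ := reduce m' (nf m) (hnfB m) ((hnfr m).trans hmm)
  have e := (AddCon.ker_rel ψ).1 (hker hk)
  have e' := (AddCon.ker_rel ψ).1 (hker hk')
  simp only [map_add, map_nsmul, h₀, smul_eq_mul] at e e'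
  have hak : a + k = b + k' := by omega
  have h1 := c.add (c.refl (a • e₀)) hk
  have h2 := c.add (c.refl (b • e₀)) hk'
  rw [← add_assoc, ← add_smul] at h1 h2
  rw [hak] at h1
  exact c.trans h1 (c.symm h2)

section Rho

variable {Γ : AddSubmonoid ℕ}

theorem mult_mem_minGens (h : mult Γ ≠ 0) : mult Γ ∈ minGens Γ := by
  have hne : {g : ℕ | g ∈ Γ ∧ g ≠ 0}.Nonempty := by
    by_contra hempty
    rw [Set.not_nonempty_iff_eq_empty] at hempty
    exact h (by rw [mult, hempty, Nat.sInf_empty])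
  refine ⟨(Nat.sInf_mem hne).1, h, fun a ha b hb ha0 hb0 hab => ?_⟩
  have h1 : mult Γ ≤ a := Nat.sInf_le ⟨ha, ha0⟩
  omega

theorem factorizationHom_single (g : minGens Γ) (n : ℕ) :
    factorizationHom Γ (Finsupp.single g n) = g * n := by
  simp [factorizationHom]

theorem factorizationHom_mem (x : minGens Γ →₀ ℕ) : factorizationHom Γ x ∈ Γ := by
  induction x using Finsupp.induction_linear with
  | zero => simp
  | add x y hx hy => rw [map_add]; exact Γ.add_mem hx hy
  | single g n =>
    rw [factorizationHom_single, mul_comm, ← smul_eq_mul]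
    exact Γ.nsmul_mem g.2.1 n

theorem eq_single_of_factorizationHom_eq {x : minGens Γ →₀ ℕ} {g : minGens Γ}
    (h : factorizationHom Γ x = g) : x = Finsupp.single g 1 := by
  have split (y : minGens Γ →₀ ℕ) (hy : y ≠ 0) : ∃ k z, y = Finsupp.single k 1 + z := by
    obtain ⟨k, hk⟩ := Finsupp.ne_iff.1 hy
    obtain ⟨z, hz⟩ := exists_add_of_le
      (Finsupp.single_le_iff.2 (Nat.one_le_iff_ne_zero.2 hk) : Finsupp.single k 1 ≤ y)
    exact ⟨k, z, hz⟩
  obtain ⟨k, z, rfl⟩ := split x (by rintro rfl; exact g.2.2.1 (by simpa using h.symm))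
  rw [map_add, factorizationHom_single, mul_one] at h
  by_cases hz : z = 0
  · subst hz
    rw [map_zero, add_zero] at h
    rw [Subtype.ext h, add_zero]
  · obtain ⟨l, z', rfl⟩ := split z hz
    refine absurd h.symm (g.2.2.2 _ k.2.1 _ (factorizationHom_mem _) k.2.2.1 ?_)
    have := l.2.2.1
    rw [map_add, factorizationHom_single, mul_one]
    omega

theorem eq_single_of_factorizationHom_modEq {x : minGens Γ →₀ ℕ} {g₀ g : minGens Γ} (hne : g ≠ g₀)
    (hmod : factorizationHom Γ x ≡ g [MOD g₀]) (hle : factorizationHom Γ x ≤ g) :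
    x = Finsupp.single g 1 := by
  obtain ⟨k, hk⟩ := (Nat.modEq_iff_dvd' hle).1 hmod
  have hg : factorizationHom Γ (x + Finsupp.single g₀ k) = g := by
    rw [map_add, factorizationHom_single]
    omega
  have h := eq_single_of_factorizationHom_eq hg
  have hk0 : k = 0 := by
    have := DFunLike.congr_fun h g₀
    rw [Finsupp.add_apply, Finsupp.single_eq_same, Finsupp.single_eq_of_ne hne.symm] at this
    omega
  simpa [hk0] using h

end Rho

/-- Every numerical monoid with embedding dimension 5 and multiplicity 11
satisfies ρ(Γ) < 14 = 𝒞(4,11). -/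
theorem rho_lt_of_edim5_mult11 (Γ : AddSubmonoid ℕ) (hΓ : IsNumericalMonoid Γ)
    (hedim : edim Γ = 5) (hmult : mult Γ = 11) :
    rho Γ < 14 := by
  classical
  have h11 : 11 ∈ minGens Γ := hmult ▸ mult_mem_minGens (by omega)
  let g₀ : minGens Γ := ⟨11, h11⟩
  have : Finite (minGens Γ) := Set.finite_of_ncard_ne_zero (by rw [← edim, hedim]; norm_num)
  have hcard : Nat.card {g : minGens Γ // g ≠ g₀} = 4 := by
    have h5 : Nat.card (minGens Γ) = 5 := hedim
    have := Fintype.ofFinite (minGens Γ)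
    rw [Nat.card_eq_fintype_card] at h5 ⊢
    rw [Fintype.card_subtype_compl, h5, Fintype.card_subtype_eq]
  let f : Fin 4 ≃ {g : minGens Γ // g ≠ g₀} := (Finite.equivFinOfCardEq hcard).symm
  let ι : (Fin 4 → ℕ) →+ (minGens Γ →₀ ℕ) :=
    ∑ i, (Finsupp.singleAddHom (f i).1).comp (Pi.evalAddMonoidHom _ i)
  have hι (m : Fin 4 → ℕ) : ι m = ∑ i, Finsupp.single (f i).1 (m i) := by
    simp [ι, AddMonoidHom.finsetSum_apply]
  have hιg₀ (m) : ι m g₀ = 0 := by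
    rw [hι, Finsupp.finsetSum_apply]
    exact Finset.sum_eq_zero fun i _ => Finsupp.single_eq_of_ne (f i).2.symm
  have hιf (m i) : ι m (f i) = m i := by
    rw [hι, Finsupp.finsetSum_apply, Finset.sum_eq_single i]
    · simp
    · intro j _ hj
      exact Finsupp.single_eq_of_ne fun h => hj (f.injective (Subtype.ext h.symm))
    · simp
  have hιX (i) : ι (Pi.single i 1) = Finsupp.single (f i).1 1 := by
    rw [hι, Finset.sum_eq_single i]
    · simp
    · intro j _ hj
      simp [hj]
    · simp
  obtain ⟨R, hfin, hR, hgen⟩ := exists_generators_of_ker (factorizationHom Γ)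
    (Finsupp.single g₀ 1) ι (by rw [factorizationHom_single, mul_one])
    (fun x => ⟨x g₀, fun i => x (f i), by
      ext g
      by_cases hg : g = g₀
      · subst hg
        simp [hιg₀]
      · obtain ⟨i, hi⟩ := f.surjective ⟨g, hg⟩
        have : g = (f i).1 := by rw [hi]
        subst this
        simp [hιf, Finsupp.single_eq_of_ne hg]⟩)
    (fun i m hmod hle => by
      rw [hιX, factorizationHom_single, mul_one] at hmod hle
      have := eq_single_of_factorizationHom_modEq (g₀ := g₀) (f i).2 hmod hle
      rw [← hιX] at this
      funext j
      rw [← hιf m j, this, hιf])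
  exact lt_of_le_of_lt (Nat.sInf_le ⟨R, hfin, rfl, hgen⟩) (by omega)
end

section
/- Every numerical monoid Γ with embedding dimension 4 and multiplicity 10 satisfies ρ(Γ) < 10. (Since 𝒞(3,10) = 10, this says 𝒭(3,10) < 𝒞(3,10).) -/
open scoped Pointwise

namespace MinimalRelations

section Staircases

/-- The minimal elements of the complement of `S`. -/
def corners {α : Type*} [LE α] (S : Set α) : Set α := {m | Minimal (· ∉ S) m}

theorem eq_of_mem_corners_of_le {α : Type*} [PartialOrder α] {S : Set α} {p q : α}
    (hp : p ∈ corners S) (hq : q ∈ corners S) (h : p ≤ q) : p = q :=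
  le_antisymm h (hq.2 hp.1 h)

theorem encard_corners_le {A : Set (ℕ × ℕ)} {i j : ℕ} (h : (i, j) ∉ A) :
    (corners A).encard ≤ i + j + 1 := by
  have hcover : corners A ⊆
      ({p ∈ corners A | p.1 < i} ∪ {p ∈ corners A | p.2 < j}) ∪ {(i, j)} := by
    intro p hp
    by_cases h1 : p.1 < i
    · exact Or.inl (Or.inl ⟨hp, h1⟩)
    by_cases h2 : p.2 < j
    · exact Or.inl (Or.inr ⟨hp, h2⟩)
    have hle : (i, j) ≤ p := ⟨not_lt.1 h1, not_lt.1 h2⟩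
    exact Or.inr (le_antisymm (hp.2 h hle) hle)
  have hx : {p ∈ corners A | p.1 < i}.encard ≤ i := by
    calc _ ≤ (Finset.range i : Set ℕ).encard :=
          Set.encard_le_encard_of_injOn (f := Prod.fst) (fun p hp => by simpa using hp.2) ?_
      _ = i := by rw [Set.encard_coe_eq_coe_finsetCard, Finset.card_range]
    rintro p ⟨hp, -⟩ q ⟨hq, -⟩ hpq
    rcases le_total p.2 q.2 with hle | hle
    · exact eq_of_mem_corners_of_le hp hq ⟨hpq.le, hle⟩
    · exact (eq_of_mem_corners_of_le hq hp ⟨hpq.ge, hle⟩).symm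
  have hy : {p ∈ corners A | p.2 < j}.encard ≤ j := by
    calc _ ≤ (Finset.range j : Set ℕ).encard :=
          Set.encard_le_encard_of_injOn (f := Prod.snd) (fun p hp => by simpa using hp.2) ?_
      _ = j := by rw [Set.encard_coe_eq_coe_finsetCard, Finset.card_range]
    rintro p ⟨hp, -⟩ q ⟨hq, -⟩ hpq
    rcases le_total p.1 q.1 with hle | hle
    · exact eq_of_mem_corners_of_le hp hq ⟨hle, hpq.le⟩
    · exact (eq_of_mem_corners_of_le hq hp ⟨hle, hpq.ge⟩).symm
  calc (corners A).encard ≤ _ := Set.encard_le_encard hcover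
    _ ≤ _ := Set.encard_union_le _ _
    _ ≤ (i + j) + 1 := by
      refine add_le_add ((Set.encard_union_le _ _).trans (add_le_add hx hy)) ?_
      simp

theorem encard_corners_le_or {A : Set (ℕ × ℕ)} (k : ℕ) :
    (corners A).encard ≤ k ∨ ∀ i j, i + j < k → (i, j) ∈ A := by
  by_contra! h
  obtain ⟨h, i, j, hij, hA⟩ := h
  refine absurd (encard_corners_le hA) (not_le.2 (lt_of_le_of_lt ?_ h))
  exact_mod_cast hij

/-- The slice of `S` by the plane on which the first coordinate is `x`. -/
def fstSlice (S : Set (ℕ × ℕ × ℕ)) (x : ℕ) : Set (ℕ × ℕ) := {p | (x, p.1, p.2) ∈ S}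

/-- The slice of `S` by the plane on which the second coordinate is `y`. -/
def sndSlice (S : Set (ℕ × ℕ × ℕ)) (y : ℕ) : Set (ℕ × ℕ) := {p | (p.1, y, p.2) ∈ S}

theorem encard_fst_corners_le (S : Set (ℕ × ℕ × ℕ)) (x : ℕ) :
    {m ∈ corners S | m.1 = x}.encard ≤ (corners (fstSlice S x)).encard := by
  refine Set.encard_le_encard_of_injOn (f := Prod.snd) ?_ ?_
  · rintro ⟨_, y, z⟩ ⟨hm, rfl⟩
    refine ⟨hm.1, fun q hq hle => ?_⟩
    exact (hm.2 hq ⟨le_rfl, hle⟩).2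
  · rintro ⟨_, p⟩ ⟨-, rfl⟩ ⟨_, q⟩ ⟨-, rfl⟩ h
    exact Prod.ext rfl h

theorem encard_snd_corners_le (S : Set (ℕ × ℕ × ℕ)) (y : ℕ) :
    {m ∈ corners S | m.2.1 = y}.encard ≤ (corners (sndSlice S y)).encard := by
  refine Set.encard_le_encard_of_injOn (f := fun m => (m.1, m.2.2)) ?_ ?_
  · rintro ⟨x, _, z⟩ ⟨hm, rfl⟩
    refine ⟨hm.1, fun q hq hle => ?_⟩
    have := hm.2 hq ⟨hle.1, le_rfl, hle.2⟩
    exact ⟨this.1, this.2.2⟩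
  · rintro ⟨x, _, z⟩ ⟨-, rfl⟩ ⟨x', _, z'⟩ ⟨-, rfl⟩ h
    simp only [Prod.mk.injEq] at h
    simp [h.1, h.2]

variable {S : Set (ℕ × ℕ × ℕ)}

theorem card_le_of_encard_le (hS : S.encard ≤ 10) (F : Finset (ℕ × ℕ × ℕ)) (hF : ∀ v ∈ F, v ∈ S) :
    F.card ≤ 10 := by
  have h := (Set.encard_le_encard (s := (F : Set (ℕ × ℕ × ℕ))) fun v hv => hF v hv).trans hS
  rw [Set.encard_coe_eq_coe_finsetCard] at h
  exact_mod_cast h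

/-- If an injective image of the points `(i, j)` with `i + j < 4`, together with one further point,
lies in `S`, then `S` has more than ten elements. -/
theorem false_of_triangle_of_mem (hS : S.encard ≤ 10) (f : ℕ × ℕ → ℕ × ℕ × ℕ)
    (hf : Function.Injective f) (h : ∀ i j, i + j < 4 → f (i, j) ∈ S) {v : ℕ × ℕ × ℕ} (hv : v ∈ S)
    (hvf : ∀ p, f p ≠ v) : False := by
  let T : Finset (ℕ × ℕ) := {p ∈ Finset.range 4 ×ˢ Finset.range 4 | p.1 + p.2 < 4}
  have hT : T.card = 10 := by decide
  have hcard := card_le_of_encard_le hS (insert v (T.image f)) (by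
    intro w hw
    rcases Finset.mem_insert.1 hw with rfl | hw
    · exact hv
    · obtain ⟨p, hp, rfl⟩ := Finset.mem_image.1 hw
      exact h p.1 p.2 (Finset.mem_filter.1 hp).2)
  rw [Finset.card_insert_of_notMem (by simpa using fun a b _ => hvf (a, b)),
    Finset.card_image_of_injective _ hf, hT] at hcard
  omega

theorem encard_corners_le_five (hS : S.encard ≤ 10) (A : Set (ℕ × ℕ)) (f : ℕ × ℕ → ℕ × ℕ × ℕ)
    (hf : Function.Injective f) (hA : ∀ p ∈ A, f p ∈ S) : (corners A).encard ≤ 5 := by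
  refine (encard_corners_le_or 5).resolve_right fun h => ?_
  let T : Finset (ℕ × ℕ) := {p ∈ Finset.range 5 ×ˢ Finset.range 5 | p.1 + p.2 < 5}
  have hT : T.card = 15 := by decide
  have hcard := card_le_of_encard_le hS (T.image f) (by
    intro w hw
    obtain ⟨p, hp, rfl⟩ := Finset.mem_image.1 hw
    exact hA _ (h p.1 p.2 (Finset.mem_filter.1 hp).2))
  rw [Finset.card_image_of_injective _ hf, hT] at hcard
  omega

theorem fst_injective (x : ℕ) : Function.Injective fun p : ℕ × ℕ => (x, p.1, p.2) := by
  rintro ⟨a, b⟩ ⟨c, d⟩ h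
  simpa using h

theorem snd_injective (y : ℕ) : Function.Injective fun p : ℕ × ℕ => (p.1, y, p.2) := by
  rintro ⟨a, b⟩ ⟨c, d⟩ h
  simpa using h

theorem encard_corners_le_of_sq_notMem (hS : S.encard ≤ 10) (h : (2, 0, 0) ∉ S) :
    (corners S).encard ≤ 9 := by
  have hcover : corners S ⊆
      ({m ∈ corners S | m.1 = 0} ∪ {m ∈ corners S | m.1 = 1}) ∪ {(2, 0, 0)} := by
    intro m hm
    by_cases h0 : m.1 = 0
    · exact Or.inl (Or.inl ⟨hm, h0⟩)
    by_cases h1 : m.1 = 1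
    · exact Or.inl (Or.inr ⟨hm, h1⟩)
    have hle : (2, 0, 0) ≤ m := ⟨show 2 ≤ m.1 by omega, Nat.zero_le _, Nat.zero_le _⟩
    exact Or.inr (le_antisymm (hm.2 h hle) hle)
  have hsum : (corners (fstSlice S 0)).encard + (corners (fstSlice S 1)).encard ≤ 8 := by
    rcases encard_corners_le_or (A := fstSlice S 0) 4 with h0 | h0
    · rcases encard_corners_le_or (A := fstSlice S 1) 4 with h1 | h1
      · exact (add_le_add h0 h1).trans (by norm_num)
      · have h5 := encard_corners_le_five hS (fstSlice S 1) _ (fst_injective 1) fun _ hp => hp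
        have h2 : ((0, 0) : ℕ × ℕ) ∉ fstSlice S 0 := fun hm =>
          false_of_triangle_of_mem hS _ (fst_injective 1) h1 hm (by simp)
        exact (add_le_add (encard_corners_le h2) h5).trans (by norm_num)
    · have h5 := encard_corners_le_five hS (fstSlice S 0) _ (fst_injective 0) fun _ hp => hp
      have h2 : ((0, 0) : ℕ × ℕ) ∉ fstSlice S 1 := fun hm =>
        false_of_triangle_of_mem hS _ (fst_injective 0) h0 hm (by simp)
      exact (add_le_add h5 (encard_corners_le h2)).trans (by norm_num)
  calc (corners S).encard ≤ _ := Set.encard_le_encard hcover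
    _ ≤ _ := Set.encard_union_le _ _
    _ ≤ 8 + 1 := add_le_add ((Set.encard_union_le _ _).trans ((add_le_add
        (encard_fst_corners_le S 0) (encard_fst_corners_le S 1)).trans hsum)) (by simp)
    _ = 9 := by norm_num

theorem encard_corners_le_of_mul_notMem (hS : S.encard ≤ 10) (h : (1, 1, 0) ∉ S) :
    (corners S).encard ≤ 9 := by
  have hcover : corners S ⊆
      ({m ∈ corners S | m.1 = 0} ∪ {m ∈ corners S | m.2.1 = 0}) ∪ {(1, 1, 0)} := by
    intro m hm
    by_cases h0 : m.1 = 0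
    · exact Or.inl (Or.inl ⟨hm, h0⟩)
    by_cases h1 : m.2.1 = 0
    · exact Or.inl (Or.inr ⟨hm, h1⟩)
    have hle : (1, 1, 0) ≤ m :=
      ⟨show 1 ≤ m.1 by omega, show 1 ≤ m.2.1 by omega, Nat.zero_le _⟩
    exact Or.inr (le_antisymm (hm.2 h hle) hle)
  have hsum : (corners (fstSlice S 0)).encard + (corners (sndSlice S 0)).encard ≤ 8 := by
    rcases encard_corners_le_or (A := fstSlice S 0) 4 with h0 | h0
    · rcases encard_corners_le_or (A := sndSlice S 0) 4 with h1 | h1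
      · exact (add_le_add h0 h1).trans (by norm_num)
      · have h5 := encard_corners_le_five hS (sndSlice S 0) _ (snd_injective 0) fun _ hp => hp
        have h2 : ((1, 0) : ℕ × ℕ) ∉ fstSlice S 0 := fun hm =>
          false_of_triangle_of_mem hS _ (snd_injective 0) h1 hm (by simp)
        exact (add_le_add (encard_corners_le h2) h5).trans (by norm_num)
    · have h5 := encard_corners_le_five hS (fstSlice S 0) _ (fst_injective 0) fun _ hp => hp
      have h2 : ((1, 0) : ℕ × ℕ) ∉ sndSlice S 0 := fun hm =>
        false_of_triangle_of_mem hS _ (fst_injective 0) h0 hm (by simp)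
      exact (add_le_add h5 (encard_corners_le h2)).trans (by norm_num)
  calc (corners S).encard ≤ _ := Set.encard_le_encard hcover
    _ ≤ _ := Set.encard_union_le _ _
    _ ≤ 8 + 1 := add_le_add ((Set.encard_union_le _ _).trans ((add_le_add
        (encard_fst_corners_le S 0) (encard_snd_corners_le S 0)).trans hsum)) (by simp)
    _ = 9 := by norm_num

/-- `ℤ/10` contains no four-element Sidon set containing `0`. -/
theorem not_nodup_sums (a b c : ZMod 10) :
    ¬ [0, a, b, c, a + a, a + b, a + c, b + b, b + c, c + c].Nodup := by
  revert a b c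
  decide +kernel

end Staircases

section NormalForms

variable {M K : Type*} [AddCommMonoid M] [AddCommMonoid K] [LinearOrder K]
  (φ : M →+ ℕ) (key : M →+ K)

/-- The elements of `M` of least key in their fibre under `φ`. -/
def normalSet : Set M := {u | ∀ v, φ v = φ u → key u ≤ key v}

theorem exists_mem_normalSet [WellFoundedLT K] (u : M) : ∃ v ∈ normalSet φ key, φ v = φ u := by
  obtain ⟨v, hv, hmin⟩ := (InvImage.wf key (wellFounded_lt (α := K))).has_min
    {v | φ v = φ u} ⟨u, rfl⟩
  exact ⟨v, fun w hw => not_lt.1 (hmin w (hw.trans hv)), hv⟩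

variable {φ key} [PartialOrder M] [CanonicallyOrderedAdd M] [IsOrderedCancelAddMonoid K]

theorem isLowerSet_normalSet : IsLowerSet (normalSet φ key) := by
  rintro u v hvu hu w hw
  obtain ⟨t, rfl⟩ := exists_add_of_le hvu
  have := hu (w + t) (by simp [hw])
  simpa using this

/-- Rewriting the minimal non-normal elements to normal ones generates the kernel congruence. -/
theorem exists_generating_set [WellFoundedLT M] [WellFoundedLT K] (hkey : Function.Injective key)
    (hfin : (corners (normalSet φ key)).Finite) :
    ∃ R : Set (M × M), R.Finite ∧ R.ncard ≤ (corners (normalSet φ key)).ncard ∧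
      addConGen (fun a b => (a, b) ∈ R) = AddCon.ker φ := by
  choose nf hnf hφ using exists_mem_normalSet φ key
  have huniq : ∀ {u v}, u ∈ normalSet φ key → φ u = φ v → u = nf v := fun {u v} hu h =>
    hkey (le_antisymm (hu _ ((hφ v).trans h.symm)) (hnf v _ (h.trans (hφ v).symm)))
  refine ⟨(fun m => (m, nf m)) '' corners (normalSet φ key), hfin.image _,
    Set.ncard_image_le hfin, le_antisymm ?_ ?_⟩
  · rw [AddCon.addConGen_le]
    rintro a b ⟨m, -, h⟩
    obtain ⟨rfl, rfl⟩ := Prod.mk.inj h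
    exact (hφ _).symm
  · set c := addConGen fun a b => (a, b) ∈ (fun m => (m, nf m)) '' corners (normalSet φ key)
    have hred : ∀ u, c u (nf u) := by
      intro u
      induction u using (InvImage.wf key (wellFounded_lt (α := K))).induction with
      | _ u ih =>
        by_cases hu : u ∈ normalSet φ key
        · rw [← huniq hu rfl]
          exact c.refl u
        obtain ⟨m, hmu, hm⟩ := exists_minimal_le_of_wellFoundedLT (· ∉ normalSet φ key) u hu
        obtain ⟨w, rfl⟩ := exists_add_of_le hmu
        have hlt : key (nf m) < key m := by
          by_contra! hle
          exact hm.1 fun v hv => hle.trans (hnf m v (hv.trans (hφ m).symm))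
        have h1 : c (m + w) (nf m + w) :=
          c.add (AddConGen.Rel.of _ _ ⟨m, hm, rfl⟩) (c.refl w)
        have h2 := ih (nf m + w) (by simpa [InvImage] using hlt)
        rw [huniq (v := m + w) (hnf (nf m + w)) (by simp [hφ])] at h2
        exact c.trans h1 h2
    intro a b hab
    have h : nf a = nf b := huniq (hnf a) ((hφ a).trans hab)
    exact c.trans (hred a) (h ▸ c.symm (hred b))

end NormalForms

section FourGenerators

variable {σ : Type*} (m : MonomialOrder σ) (val : σ → ℕ) (o : σ)

/-- The homomorphism sending the basis vector at `g` to `val g`. -/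
noncomputable def evalHom : (σ →₀ ℕ) →+ ℕ :=
  Finsupp.liftAddHom fun g => AddMonoidHom.mulLeft (val g)

@[simp]
theorem evalHom_single (g : σ) (n : ℕ) : evalHom val (Finsupp.single g n) = val g * n := by
  simp [evalHom]

/-- The exponent with prescribed values at `i`, `j` and `k`. -/
noncomputable def vec (i j k : σ) (v : ℕ × ℕ × ℕ) : σ →₀ ℕ :=
  Finsupp.single i v.1 + Finsupp.single j v.2.1 + Finsupp.single k v.2.2

theorem vec_mono (i j k : σ) : Monotone (vec i j k) := fun _ _ huv =>
  add_le_add (add_le_add (Finsupp.single_le_single.2 huv.1) (Finsupp.single_le_single.2 huv.2.1))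
    (Finsupp.single_le_single.2 huv.2.2)

variable [DecidableEq σ]

theorem evalHom_eq (u : σ →₀ ℕ) :
    evalHom val u = evalHom (Function.update val o 0) u + val o * u o := by
  induction u using Finsupp.induction_linear with
  | zero => simp
  | add u v hu hv => simp only [map_add, hu, hv, Finsupp.add_apply]; ring
  | single g n =>
    by_cases h : g = o
    · subst h; simp
    · simp [h]

/-- Compare by the value away from `o`, and break ties by a monomial order. -/
noncomputable def weightKey : (σ →₀ ℕ) →+ ℕ ×ₗ m.syn where
  toFun u := toLex (evalHom (Function.update val o 0) u, m.toSyn u)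
  map_zero' := by simp
  map_add' u v := by simp only [map_add]; rfl

theorem weightKey_injective : Function.Injective (weightKey m val o) := fun _ _ h =>
  m.toSyn.injective (congrArg (fun x => (ofLex x).2) h)

theorem weightKey_lt_of_lt {u v : σ →₀ ℕ}
    (h : evalHom (Function.update val o 0) u < evalHom (Function.update val o 0) v) :
    weightKey m val o u < weightKey m val o v :=
  Prod.Lex.toLex_lt_toLex.2 (Or.inl h)

theorem eval_le_of_weightKey_le {u v : σ →₀ ℕ} (h : weightKey m val o u ≤ weightKey m val o v) :
    evalHom (Function.update val o 0) u ≤ evalHom (Function.update val o 0) v := by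
  by_contra! hlt
  exact (weightKey_lt_of_lt m val o hlt).not_ge h

/-- The exponents that are normal with respect to `weightKey`. -/
abbrev normalExponents : Set (σ →₀ ℕ) := normalSet (evalHom val) (weightKey m val o)

variable {m val o}

theorem apply_eq_zero_of_mem_corners (ho : 0 < val o) {u : σ →₀ ℕ}
    (hu : u ∈ corners (normalExponents m val o)) : u o = 0 := by
  by_contra h
  have hsplit : ∀ v : σ →₀ ℕ, v o ≠ 0 → v - Finsupp.single o 1 + Finsupp.single o 1 = v :=
    fun v hv => tsub_add_cancel_of_le (by simpa [Nat.one_le_iff_ne_zero] using hv)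
  have hnormal : u - Finsupp.single o 1 ∈ normalExponents m val o := by
    by_contra hn
    have := hu.2 hn tsub_le_self o
    simp at this
    omega
  refine hu.1 fun v hv => ?_
  by_contra! hlt
  have hw := eval_le_of_weightKey_le m val o hlt.le
  rw [evalHom_eq val o v, evalHom_eq val o u] at hv
  have hvo : v o ≠ 0 := by
    have hle : u o ≤ v o := by
      have : val o * u o ≤ val o * v o := by omega
      exact Nat.le_of_mul_le_mul_left this ho
    omega
  have hv' : evalHom val v = evalHom val u := by rw [evalHom_eq val o v, evalHom_eq val o u, hv]
  rw [← hsplit u h, ← hsplit v hvo] at hv' hlt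
  rw [map_add, map_add] at hv' hlt
  exact hlt.not_ge (add_le_add_left (hnormal _ (by omega)) _)

theorem eq_of_cast_eq {u v : σ →₀ ℕ} (hu : u ∈ normalExponents m val o)
    (hv : v ∈ normalExponents m val o) (huo : u o = 0) (hvo : v o = 0)
    (h : (evalHom val u : ZMod (val o)) = evalHom val v) : u = v := by
  wlog hle : evalHom val u ≤ evalHom val v generalizing u v
  · exact (this hv hu hvo huo h.symm (le_of_not_ge hle)).symm
  rw [ZMod.natCast_eq_natCast_iff, Nat.modEq_iff_dvd' hle] at h
  obtain ⟨k, hk⟩ := h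
  have hval : evalHom val (u + Finsupp.single o k) = evalHom val v := by
    rw [map_add, evalHom_single]
    omega
  have hw := eval_le_of_weightKey_le m val o (hv _ hval)
  have hu' := evalHom_eq val o u
  have hv' := evalHom_eq val o v
  simp only [map_add, evalHom_single, Function.update_self, zero_mul, add_zero, huo, hvo,
    mul_zero] at hw hu' hv'
  have heq : evalHom val u = evalHom val v := le_antisymm hle (by omega)
  exact weightKey_injective m val o (le_antisymm (hu _ heq.symm) (hv _ heq))

/-- The type `σ` consists of the four distinct elements `o`, `i`, `j` and `k`. -/
structure IsLabelling (o i j k : σ) : Prop where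
  nodup : [o, i, j, k].Nodup
  mem : ∀ g, g ∈ [o, i, j, k]

namespace IsLabelling

variable {i j k : σ}

theorem rotate (h : IsLabelling o i j k) : IsLabelling o j k i where
  nodup := by have := h.nodup; grind
  mem g := by have := h.mem g; grind

theorem apply_vec (h : IsLabelling o i j k) (v : ℕ × ℕ × ℕ) :
    vec i j k v o = 0 ∧ vec i j k v i = v.1 ∧ vec i j k v j = v.2.1 ∧ vec i j k v k = v.2.2 := by
  have := h.nodup
  simp only [List.nodup_cons, List.mem_cons, List.not_mem_nil, or_false, not_or] at this
  simp [vec, Finsupp.single_apply]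
  grind

theorem eq_vec (h : IsLabelling o i j k) {u : σ →₀ ℕ} (hu : u o = 0) :
    u = vec i j k (u i, u j, u k) := by
  obtain ⟨ho, hi, hj, hk⟩ := h.apply_vec (u i, u j, u k)
  ext g
  have := h.mem g
  simp only [List.mem_cons, List.not_mem_nil, or_false] at this
  rcases this with rfl | rfl | rfl | rfl
  · rw [hu, ho]
  · rw [hi]
  · rw [hj]
  · rw [hk]

theorem encard_corners_le_vec (h : IsLabelling o i j k) (ho : 0 < val o) :
    (corners (normalExponents m val o)).encard ≤
      (corners (vec i j k ⁻¹' normalExponents m val o)).encard := by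
  refine Set.encard_le_encard_of_injOn (f := fun u => (u i, u j, u k)) ?_ ?_
  · intro u hu
    have huv := h.eq_vec (apply_eq_zero_of_mem_corners ho hu)
    refine ⟨fun hn => hu.1 (huv ▸ hn), fun q hq hle => ?_⟩
    have hle' := hu.2 hq (huv ▸ vec_mono i j k hle)
    obtain ⟨-, hi, hj, hk⟩ := h.apply_vec q
    exact ⟨hi ▸ hle' i, hj ▸ hle' j, hk ▸ hle' k⟩
  · intro u hu v hv huv
    rw [h.eq_vec (apply_eq_zero_of_mem_corners ho hu),
      h.eq_vec (apply_eq_zero_of_mem_corners ho hv)]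
    exact congrArg _ huv

theorem injOn_cast (h : IsLabelling o i j k) (ho : val o = 10) :
    Set.InjOn (fun v => (evalHom val (vec i j k v) : ZMod 10))
      (vec i j k ⁻¹' normalExponents m val o) := by
  intro u hu v hv huv
  have := eq_of_cast_eq hu hv (h.apply_vec u).1 (h.apply_vec v).1 (by rw [ho]; exact huv)
  obtain ⟨-, hi, hj, hk⟩ := h.apply_vec u
  obtain ⟨-, hi', hj', hk'⟩ := h.apply_vec v
  rw [this] at hi hj hk
  exact Prod.ext (hi.symm.trans hi') (Prod.ext (hj.symm.trans hj') (hk.symm.trans hk'))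

theorem encard_preimage_le (h : IsLabelling o i j k) (ho : val o = 10) :
    (vec i j k ⁻¹' normalExponents m val o).encard ≤ 10 := by
  calc _ ≤ (Set.univ : Set (ZMod 10)).encard :=
        Set.encard_le_encard_of_injOn (fun _ _ => Set.mem_univ _) (h.injOn_cast ho)
    _ = 10 := by simp [Set.encard_univ]

theorem encard_corners_le_or_mem (h : IsLabelling o i j k) (ho : val o = 10) :
    (corners (normalExponents m val o)).encard ≤ 9 ∨
      vec i j k (2, 0, 0) ∈ normalExponents m val o ∧
        vec i j k (1, 1, 0) ∈ normalExponents m val o := by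
  by_contra! hcon
  obtain ⟨h9, himp⟩ := hcon
  refine h9.not_ge ((h.encard_corners_le_vec (by omega)).trans ?_)
  by_cases hsq : vec i j k (2, 0, 0) ∈ normalExponents m val o
  · exact encard_corners_le_of_mul_notMem (h.encard_preimage_le ho) (himp hsq)
  · exact encard_corners_le_of_sq_notMem (h.encard_preimage_le ho) hsq

theorem encard_corners_le_nine (h : IsLabelling o i j k) (ho : val o = 10) :
    (corners (normalExponents m val o)).encard ≤ 9 := by
  by_contra hcon
  obtain ⟨hii, hij⟩ := (h.encard_corners_le_or_mem ho).resolve_left hcon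
  obtain ⟨hjj, hjk⟩ := (h.rotate.encard_corners_le_or_mem ho).resolve_left hcon
  obtain ⟨hkk, hki⟩ := (h.rotate.rotate.encard_corners_le_or_mem ho).resolve_left hcon
  let l : List (ℕ × ℕ × ℕ) := [(0, 0, 0), (1, 0, 0), (0, 1, 0), (0, 0, 1), (2, 0, 0), (1, 1, 0),
    (1, 0, 1), (0, 2, 0), (0, 1, 1), (0, 0, 2)]
  have hjj' : vec i j k (0, 2, 0) ∈ normalExponents m val o := by
    convert hjj using 1; simp [vec]
  have hkk' : vec i j k (0, 0, 2) ∈ normalExponents m val o := by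
    convert hkk using 1; simp [vec]
  have hjk' : vec i j k (0, 1, 1) ∈ normalExponents m val o := by
    convert hjk using 1; simp [vec]
  have hki' : vec i j k (1, 0, 1) ∈ normalExponents m val o := by
    convert hki using 1; simp [vec, add_comm]
  have hlower : ∀ {u v}, v ≤ u → vec i j k u ∈ normalExponents m val o →
      vec i j k v ∈ normalExponents m val o := fun hvu =>
    isLowerSet_normalSet (vec_mono i j k hvu)
  have hmem : ∀ v ∈ l, v ∈ vec i j k ⁻¹' normalExponents m val o := by
    simp only [l, List.forall_mem_cons, Set.mem_preimage]
    exact ⟨hlower (by decide) hii, hlower (by decide) hii, hlower (by decide) hjj',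
      hlower (by decide) hkk', hii, hij, hki', hjj', hjk', hkk', by simp⟩
  have hnodup := List.Nodup.map_on (f := fun v => (evalHom val (vec i j k v) : ZMod 10))
    (fun u hu v hv huv => h.injOn_cast ho (hmem u hu) (hmem v hv) huv)
    (show l.Nodup by decide)
  refine not_nodup_sums (val i) (val j) (val k) ?_
  simpa only [l, List.map_cons, List.map_nil, vec, map_add, evalHom_single, mul_zero, mul_one,
    zero_add, add_zero, mul_two, Nat.cast_add, Nat.cast_zero] using hnodup

end IsLabelling

end FourGenerators

theorem mem_minGens_of_mult {Γ : AddSubmonoid ℕ} (h : mult Γ ≠ 0) : mult Γ ∈ minGens Γ := by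
  have hne : {g : ℕ | g ∈ Γ ∧ g ≠ 0}.Nonempty := Set.nonempty_iff_ne_empty.2 fun he =>
    h (by rw [mult, he, Nat.sInf_empty])
  have hmem := Nat.sInf_mem hne
  refine ⟨hmem.1, hmem.2, fun a ha b _ ha0 hb0 hab => ?_⟩
  have : mult Γ ≤ a := Nat.sInf_le ⟨ha, ha0⟩
  omega

theorem exists_isLabelling {Γ : AddSubmonoid ℕ} (hedim : edim Γ = 4) (o : minGens Γ) :
    ∃ i j k, IsLabelling o i j k := by
  have hfin : (minGens Γ).Finite := Set.finite_of_ncard_ne_zero (by rw [edim] at hedim; omega)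
  have : Finite (minGens Γ) := hfin
  have hcard : ({o}ᶜ : Set (minGens Γ)).ncard = 3 := by
    rw [Set.ncard_compl, Set.ncard_singleton, Nat.card_coe_set_eq]
    rw [edim] at hedim
    omega
  obtain ⟨i, j, k, hij, hik, hjk, hs⟩ := Set.ncard_eq_three.1 hcard
  have hmem : ∀ g, g ≠ o ↔ g = i ∨ g = j ∨ g = k := fun g => by
    simpa using Set.ext_iff.1 hs g
  refine ⟨i, j, k, ?_, fun g => ?_⟩
  · have hi := (hmem i).2 (Or.inl rfl)
    have hj := (hmem j).2 (Or.inr (Or.inl rfl))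
    have hk := (hmem k).2 (Or.inr (Or.inr rfl))
    simp [hij, hik, hjk, hi.symm, hj.symm, hk.symm]
  · by_cases hg : g = o
    · simp [hg]
    · simpa [hg] using (hmem g).1 hg

end MinimalRelations

/-- Every numerical monoid with embedding dimension 4 and multiplicity 10
satisfies ρ(Γ) < 10 = 𝒞(3,10). -/
theorem rho_lt_of_edim4_mult10 (Γ : AddSubmonoid ℕ) (hΓ : IsNumericalMonoid Γ)
    (hedim : edim Γ = 4) (hmult : mult Γ = 10) :
    rho Γ < 10 := by
  have : Finite (minGens Γ) := Set.finite_of_ncard_ne_zero (by rw [edim] at hedim; omega)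
  let o : minGens Γ := ⟨mult Γ, MinimalRelations.mem_minGens_of_mult (by omega)⟩
  obtain ⟨i, j, k, h⟩ := MinimalRelations.exists_isLabelling hedim o
  have h9 := h.encard_corners_le_nine (m := MonomialOrder.lex) (val := Subtype.val) hmult
  have hfin := Set.finite_of_encard_le_coe h9
  rw [← hfin.cast_ncard_eq, Nat.cast_le_ofNat] at h9
  obtain ⟨R, hR, hcard, hgen⟩ :=
    MinimalRelations.exists_generating_set (MinimalRelations.weightKey_injective _ _ _) hfin
  have hrho : rho Γ ≤ R.ncard := Nat.sInf_le ⟨R, hR, rfl, hgen⟩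
  exact Nat.lt_succ_of_le (hrho.trans (hcard.trans h9))
end

section
/- For all integers e, m with 3 ≤ e < m and m − e ≤ 6: every numerical monoid Γ with embedding dimension e+1 and multiplicity m satisfies type(Γ) ≤ 𝒟(e,m), and there exists a numerical monoid Γ with embedding dimension e+1, multiplicity m, and type(Γ) = 𝒟(e,m). -/
open scoped Pointwise

lemma sSup_choose_le_eq {d n a : ℕ} (h₁ : a.choose (d + 1) ≤ n)
    (h₂ : n < (a + 1).choose (d + 1)) : sSup {b : ℕ | b.choose (d + 1) ≤ n} = a := by
  refine IsGreatest.csSup_eq ⟨h₁, fun b hb => ?_⟩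
  by_contra! hlt
  have := Nat.choose_le_choose (d + 1) (show a + 1 ≤ b from hlt)
  simp only [Set.mem_ofPred_eq] at hb
  omega

lemma macR_eq_two {e m : ℕ} (he : 3 ≤ e) (hem : e < m) (hd : m ≤ e + 6) : macR e m = 2 := by
  refine IsLeast.csInf_eq ⟨⟨by norm_num, ?_⟩, fun r hr => ?_⟩
  · have h : (e + 2).choose 2 = (e + 1) + (e + 1).choose 2 := by
      rw [Nat.choose_succ_succ' (e + 1) 1, Nat.choose_one_right]
    have h' : (e + 1).choose 2 = e + e.choose 2 := by
      rw [Nat.choose_succ_succ' e 1, Nat.choose_one_right]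
    have h'' : (3 : ℕ).choose 2 ≤ e.choose 2 := Nat.choose_le_choose 2 he
    have : (3 : ℕ).choose 2 = 3 := rfl
    omega
  · obtain ⟨h0, h1⟩ := hr
    by_contra! hlt
    obtain rfl : r = 1 := by omega
    rw [Nat.choose_one_right] at h1
    omega

lemma mathcalD_eq_of_small_diff {e n : ℕ} (he : 3 ≤ e) (hn : n ≤ 5) :
    mathcalD e (e + 1 + n) = e + if n ≤ 2 then 0 else if n ≤ 4 then 1 else 2 := by
  have h : macR e (e + 1 + n) = 2 := macR_eq_two he (by omega) (by omega)
  have h2 : e + 1 + n - (e + 2 - 1).choose (2 - 1) = n := by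
    simp
  rw [mathcalD, h, h2]
  congr 1
  · simp
  interval_cases n
  · simp [macLower]
  · have h₁ : sSup {b : ℕ | b.choose (1 + 1) ≤ 1} = 2 := sSup_choose_le_eq (by decide) (by decide)
    simp [macLower, h₁]
  · have h₁ : sSup {b : ℕ | b.choose (1 + 1) ≤ 2} = 2 := sSup_choose_le_eq (by decide) (by decide)
    have h₂ : sSup {b : ℕ | b.choose (0 + 1) ≤ 1} = 1 := sSup_choose_le_eq (by decide) (by decide)
    simp only [macLower, h₁]
    norm_num at h₂ ⊢
    simp [h₂]
  · have h₁ : sSup {b : ℕ | b.choose (1 + 1) ≤ 3} = 3 := sSup_choose_le_eq (by decide) (by decide)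
    simp [macLower, h₁]
  · have h₁ : sSup {b : ℕ | b.choose (1 + 1) ≤ 4} = 3 := sSup_choose_le_eq (by decide) (by decide)
    have h₂ : sSup {b : ℕ | b.choose (0 + 1) ≤ 1} = 1 := sSup_choose_le_eq (by decide) (by decide)
    simp only [macLower, h₁]
    norm_num [Nat.choose] at h₂ ⊢
    simp [h₂]
  · have h₁ : sSup {b : ℕ | b.choose (1 + 1) ≤ 5} = 3 := sSup_choose_le_eq (by decide) (by decide)
    have h₂ : sSup {b : ℕ | b.choose (0 + 1) ≤ 2} = 2 := sSup_choose_le_eq (by decide) (by decide)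
    simp only [macLower, h₁]
    norm_num [Nat.choose] at h₂ ⊢
    simp [h₂]

section UpperBound

variable {Γ : AddSubmonoid ℕ}

lemma IsNumericalMonoid.exists_mem_mod_eq (hΓ : IsNumericalMonoid Γ) {m i : ℕ} (hi : i < m) :
    ∃ g ∈ Γ, g % m = i := by
  by_contra! h
  have hinj : Function.Injective fun k : ℕ => i + m * k := fun a b hab =>
    Nat.eq_of_mul_eq_mul_left (by omega : 0 < m) (Nat.add_left_cancel hab)
  refine Set.infinite_range_of_injective hinj (hΓ.subset ?_)
  rintro _ ⟨k, rfl⟩ hk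
  exact h _ hk (by simp [Nat.add_mul_mod_self_left, Nat.mod_eq_of_lt hi])

lemma IsNumericalMonoid.mult_mem (hΓ : IsNumericalMonoid Γ) : mult Γ ∈ Γ ∧ mult Γ ≠ 0 := by
  obtain ⟨g, hg⟩ := (hΓ.union (Set.finite_singleton 0)).exists_notMem
  simp only [Set.mem_union, Set.mem_compl_iff, Set.mem_singleton_iff, not_or, not_not] at hg
  exact Nat.sInf_mem (s := {g : ℕ | g ∈ Γ ∧ g ≠ 0}) ⟨g, hg⟩

lemma mem_of_mod_eq_of_le {m a b : ℕ} (hm : m ∈ Γ) (ha : a ∈ Γ) (hab : a ≤ b)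
    (h : a % m = b % m) : b ∈ Γ := by
  obtain ⟨k, hk⟩ := (Nat.modEq_iff_dvd' hab).1 h
  have : b = a + k • m := by rw [smul_eq_mul, mul_comm]; omega
  rw [this]
  exact Γ.add_mem ha (Γ.nsmul_mem hm k)

lemma bijOn_mod_aperySet (hΓ : IsNumericalMonoid Γ) :
    Set.BijOn (· % mult Γ) (aperySet Γ) (Set.Iio (mult Γ)) := by
  obtain ⟨hm, hm0⟩ := hΓ.mult_mem
  refine ⟨fun a _ => Nat.mod_lt _ (by omega), ?_, fun i hi => ?_⟩
  · have key : ∀ a ∈ aperySet Γ, ∀ b ∈ aperySet Γ, a % mult Γ = b % mult Γ → ¬ a < b := by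
      intro a ha b hb h hlt
      have hdvd := (Nat.modEq_iff_dvd' hlt.le).1 h
      have hle := Nat.le_of_dvd (by omega) hdvd
      refine hb.2 ⟨b - mult Γ, mem_of_mod_eq_of_le hm ha.1 (by omega) ?_, by omega⟩
      rw [h, Nat.mod_eq_sub_mod (by omega)]
    intro a ha b hb h
    exact le_antisymm (not_lt.1 (key b hb a ha h.symm)) (not_lt.1 (key a ha b hb h))
  · classical
    have hex := hΓ.exists_mem_mod_eq hi
    refine ⟨Nat.find hex, ⟨(Nat.find_spec hex).1, ?_⟩, (Nat.find_spec hex).2⟩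
    rintro ⟨γ, hγ, h⟩
    refine Nat.find_min hex (m := γ) (by omega) ⟨hγ, ?_⟩
    have := (Nat.find_spec hex).2
    rwa [h, Nat.add_mod_right] at this

lemma ncard_aperySet (hΓ : IsNumericalMonoid Γ) : (aperySet Γ).ncard = mult Γ := by
  have h := bijOn_mod_aperySet hΓ
  rw [← h.injOn.ncard_image, h.image_eq]
  simp [Set.ncard_eq_toFinset_card']

lemma finite_aperySet (hΓ : IsNumericalMonoid Γ) : (aperySet Γ).Finite :=
  Set.finite_of_ncard_ne_zero (by rw [ncard_aperySet hΓ]; exact hΓ.mult_mem.2)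

lemma zero_mem_aperySet (hΓ : IsNumericalMonoid Γ) : 0 ∈ aperySet Γ :=
  ⟨Γ.zero_mem, fun ⟨_, _, h⟩ => hΓ.mult_mem.2 (by omega)⟩

lemma left_mem_aperySet_of_add_mem {a b : ℕ} (ha : a ∈ Γ) (hb : b ∈ Γ)
    (h : a + b ∈ aperySet Γ) : a ∈ aperySet Γ := by
  refine ⟨ha, ?_⟩
  rintro ⟨γ, hγ, rfl⟩
  exact h.2 ⟨γ + b, Γ.add_mem hγ hb, by omega⟩

/-- The nonzero elements of the Apéry set that are not maximal for divisibility in `Γ`. -/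
def nonmaximalApery (Γ : AddSubmonoid ℕ) : Set ℕ :=
  {a | a ∈ aperySet Γ ∧ a ≠ 0 ∧ ∃ b ∈ Γ, b ≠ 0 ∧ a + b ∈ aperySet Γ}

lemma finite_nonmaximalApery (hΓ : IsNumericalMonoid Γ) : (nonmaximalApery Γ).Finite :=
  (finite_aperySet hΓ).subset fun _ h => h.1

lemma numType_add_ncard_nonmaximalApery_lt (hΓ : IsNumericalMonoid Γ) :
    numType Γ + (nonmaximalApery Γ).ncard < mult Γ := by
  obtain ⟨hm, hm0⟩ := hΓ.mult_mem
  have hfin := finite_aperySet hΓ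
  have hsub : insert 0 (nonmaximalApery Γ) ⊆ aperySet Γ :=
    Set.insert_subset (zero_mem_aperySet hΓ) fun _ h => h.1
  have h1 : numType Γ ≤ (aperySet Γ \ insert 0 (nonmaximalApery Γ)).ncard := by
    refine Set.ncard_le_ncard_of_injOn (· + mult Γ) ?_ (add_left_injective _).injOn
      (hfin.subset Set.sdiff_subset)
    rintro p ⟨hp, hpg⟩
    refine ⟨⟨hpg _ hm hm0, ?_⟩, ?_⟩
    · rintro ⟨γ, hγ, h⟩
      exact hp (by rwa [Nat.add_right_cancel h])
    · rintro (h | ⟨-, -, b, hb, hb0, hab⟩)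
      · omega
      · exact hab.2 ⟨p + b, hpg b hb hb0, by omega⟩
  have h2 := Set.ncard_sdiff_add_ncard_of_subset hsub hfin
  rw [Set.ncard_insert_of_notMem (fun h => h.2.1 rfl) (finite_nonmaximalApery hΓ),
    ncard_aperySet hΓ] at h2
  omega

lemma mult_le_edim_add_choose (hΓ : IsNumericalMonoid Γ) (hpos : 0 < edim Γ) :
    mult Γ ≤ edim Γ + ((nonmaximalApery Γ).ncard + 1).choose 2 := by
  classical
  obtain ⟨hm, hm0⟩ := hΓ.mult_mem
  have hN := finite_nonmaximalApery hΓ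
  have hgen : (minGens Γ).Finite := Set.finite_of_ncard_pos hpos
  have hmgen : mult Γ ∈ minGens Γ := by
    refine ⟨hm, hm0, fun a ha b hb ha0 hb0 h => ?_⟩
    have : mult Γ ≤ a := Nat.sInf_le ⟨ha, ha0⟩
    omega
  let T : Finset ℕ := hN.toFinset.sym2.image (Sym2.lift ⟨fun a b => a + b, add_comm⟩)
  have hT : T.card ≤ ((nonmaximalApery Γ).ncard + 1).choose 2 := by
    refine Finset.card_image_le.trans ?_
    rw [Finset.card_sym2, Set.ncard_eq_toFinset_card _ hN]
  have hsub : aperySet Γ ⊆ insert 0 (minGens Γ \ {mult Γ}) ∪ (T : Set ℕ) := by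
    intro w hw
    by_cases hw0 : w = 0
    · exact Or.inl (Or.inl hw0)
    by_cases hwg : w ∈ minGens Γ
    · refine Or.inl (Or.inr ⟨hwg, fun h => hw.2 ⟨0, Γ.zero_mem, ?_⟩⟩)
      rw [Set.mem_singleton_iff] at h
      omega
    · right
      have : ∃ a ∈ Γ, ∃ b ∈ Γ, a ≠ 0 ∧ b ≠ 0 ∧ w = a + b := by
        by_contra! h
        exact hwg ⟨hw.1, hw0, h⟩
      obtain ⟨a, ha, b, hb, ha0, hb0, rfl⟩ := this
      have hba : b + a ∈ aperySet Γ := by rwa [add_comm]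
      rw [Finset.mem_coe, Finset.mem_image]
      refine ⟨s(a, b), ?_, rfl⟩
      rw [Finset.mk_mem_sym2_iff, hN.mem_toFinset, hN.mem_toFinset]
      exact ⟨⟨left_mem_aperySet_of_add_mem ha hb hw, ha0, b, hb, hb0, hw⟩,
        ⟨left_mem_aperySet_of_add_mem hb ha hba, hb0, a, ha, ha0, hba⟩⟩
  have h1 := Set.ncard_le_ncard hsub ((hgen.sdiff.insert 0).union T.finite_toSet)
  have h2 := Set.ncard_union_le (insert 0 (minGens Γ \ {mult Γ})) (T : Set ℕ)
  have h3 := Set.ncard_insert_le 0 (minGens Γ \ {mult Γ})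
  have h4 := Set.ncard_sdiff_singleton_add_one hmgen hgen
  rw [ncard_aperySet hΓ] at h1
  rw [Set.ncard_coe_finset] at h2
  rw [edim]
  omega

end UpperBound

section Construction

/-- The monoid `{0} ∪ {m} ∪ (m + A) ∪ [2m, ∞)`. -/
def levelTwoMonoid (m : ℕ) (A : Finset ℕ) : AddSubmonoid ℕ where
  carrier := {x | x = 0 ∨ x = m ∨ (∃ a ∈ A, x = m + a) ∨ 2 * m ≤ x}
  zero_mem' := Or.inl rfl
  add_mem' := by
    rintro x y (rfl | rfl | ⟨a, ha, rfl⟩ | hx) (rfl | rfl | ⟨b, hb, rfl⟩ | hy)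
    all_goals first
      | exact Or.inr (Or.inr (Or.inr (by omega)))
      | simp_all

variable {m : ℕ} {A : Finset ℕ}

lemma mem_levelTwoMonoid {x : ℕ} : x ∈ levelTwoMonoid m A ↔
    x = 0 ∨ x = m ∨ (∃ a ∈ A, x = m + a) ∨ 2 * m ≤ x := Iff.rfl

lemma add_mem_levelTwoMonoid_iff {i : ℕ} (hi : 0 < i) (him : i < m) :
    m + i ∈ levelTwoMonoid m A ↔ i ∈ A := by
  rw [mem_levelTwoMonoid]
  constructor
  · rintro (h | h | ⟨a, ha, h⟩ | h)
    · omega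
    · omega
    · rwa [Nat.add_left_cancel h]
    · omega
  · exact fun h => Or.inr (Or.inr (Or.inl ⟨i, h, rfl⟩))

lemma le_of_mem_levelTwoMonoid {x : ℕ} (hx : x ∈ levelTwoMonoid m A) (hx0 : x ≠ 0) : m ≤ x := by
  rcases hx with h | h | ⟨a, -, h⟩ | h <;> omega

lemma self_mem_levelTwoMonoid : m ∈ levelTwoMonoid m A := Or.inr (Or.inl rfl)

lemma isNumericalMonoid_levelTwoMonoid : IsNumericalMonoid (levelTwoMonoid m A) :=
  (Set.finite_Iio (2 * m)).subset fun x hx => by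
    by_contra h
    exact hx (Or.inr (Or.inr (Or.inr (not_lt.1 h))))

lemma mult_levelTwoMonoid (hm : 0 < m) : mult (levelTwoMonoid m A) = m :=
  IsLeast.csInf_eq ⟨⟨self_mem_levelTwoMonoid, hm.ne'⟩,
    fun _ hx => le_of_mem_levelTwoMonoid hx.1 hx.2⟩

lemma pseudoFrobenius_levelTwoMonoid (hA : ∀ a ∈ A, 0 < a ∧ a < m)
    (hA' : ∀ a ∈ A, ∃ b ∈ A, a + b < m ∧ a + b ∉ A) (hm : 1 < m) :
    pseudoFrobenius (levelTwoMonoid m A) =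
      ((Finset.Ico 1 m \ A).image (m + ·) : Finset ℕ) := by
  ext p
  simp only [Finset.coe_image, Set.mem_image, Finset.mem_coe, Finset.mem_sdiff, Finset.mem_Ico]
  constructor
  · rintro ⟨hp, hpg⟩
    have hp2 : p < 2 * m := by
      by_contra h
      exact hp (Or.inr (Or.inr (Or.inr (not_lt.1 h))))
    have hp0 : p ≠ 0 := by rintro rfl; exact hp (Or.inl rfl)
    have hpm : p ≠ m := by rintro rfl; exact hp self_mem_levelTwoMonoid
    rcases lt_or_gt_of_ne hpm with hlt | hgt
    · have hpA : p ∈ A := by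
        have := hpg m self_mem_levelTwoMonoid (by omega)
        rwa [add_comm, add_mem_levelTwoMonoid_iff (by omega) hlt] at this
      obtain ⟨b, hb, hlt', hnot⟩ := hA' p hpA
      have := hpg (m + b) (Or.inr (Or.inr (Or.inl ⟨b, hb, rfl⟩))) (by omega)
      rw [add_left_comm, add_mem_levelTwoMonoid_iff (by omega) hlt'] at this
      exact absurd this hnot
    · refine ⟨p - m, ⟨⟨by omega, by omega⟩, fun h => hp ?_⟩, by omega⟩
      exact Or.inr (Or.inr (Or.inl ⟨_, h, by omega⟩))
  · rintro ⟨i, ⟨⟨h1, h2⟩, h3⟩, rfl⟩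
    refine ⟨fun h => h3 ((add_mem_levelTwoMonoid_iff (by omega) h2).1 h), fun g hg hg0 => ?_⟩
    have := le_of_mem_levelTwoMonoid hg hg0
    exact Or.inr (Or.inr (Or.inr (by omega)))

lemma numType_levelTwoMonoid (hA : ∀ a ∈ A, 0 < a ∧ a < m)
    (hA' : ∀ a ∈ A, ∃ b ∈ A, a + b < m ∧ a + b ∉ A) (hm : 1 < m) :
    numType (levelTwoMonoid m A) = m - 1 - A.card := by
  rw [numType, pseudoFrobenius_levelTwoMonoid hA hA' hm, Set.ncard_coe_finset,
    Finset.card_image_of_injective _ (add_right_injective m), Finset.card_sdiff_of_subset,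
    Nat.card_Ico]
  intro a ha
  have := hA a ha
  rw [Finset.mem_Ico]
  omega

lemma minGens_levelTwoMonoid {B : Finset ℕ} (hA : ∀ a ∈ A, 0 < a ∧ a < m)
    (hB : ∀ b, b ∈ B ↔ b < m ∧ b ∉ A ∧ ∃ a ∈ A, ∃ a' ∈ A, b = a + a') (hm : 0 < m) :
    minGens (levelTwoMonoid m A) = ((Finset.range m \ B).image
      fun i => if i = 0 ∨ i ∈ A then m + i else 2 * m + i : Finset ℕ) := by
  ext g
  simp only [Finset.coe_image, Set.mem_image, Finset.mem_coe, Finset.mem_sdiff, Finset.mem_range]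
  constructor
  · rintro ⟨hg, hg0, hsum⟩
    have h3 : g < 3 * m := by
      by_contra! h
      exact hsum m self_mem_levelTwoMonoid (g - m) (Or.inr (Or.inr (Or.inr (by omega))))
        (by omega) (by omega) (by omega)
    have h2 : g ≠ 2 * m := fun h => hsum m self_mem_levelTwoMonoid m self_mem_levelTwoMonoid
      (by omega) (by omega) (by omega)
    rcases hg with h | h | ⟨a, ha, h⟩ | h
    · exact absurd h hg0
    · exact ⟨0, ⟨hm, fun h0 => by
        obtain ⟨-, -, a, ha, a', -, h⟩ := (hB 0).1 h0
        have := hA a ha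
        omega⟩, by simp [h]⟩
    · exact ⟨a, ⟨(hA a ha).2, fun h' => ((hB a).1 h').2.1 ha⟩, by simp [ha, h]⟩
    · have hnA : g - 2 * m ∉ A := fun hA0 => hsum m self_mem_levelTwoMonoid (m + (g - 2 * m))
        (Or.inr (Or.inr (Or.inl ⟨_, hA0, rfl⟩))) (by omega) (by omega) (by omega)
      refine ⟨g - 2 * m, ⟨by omega, fun hB0 => ?_⟩, ?_⟩
      · obtain ⟨-, -, a, ha, a', ha', h'⟩ := (hB _).1 hB0
        exact hsum (m + a) (Or.inr (Or.inr (Or.inl ⟨a, ha, rfl⟩))) (m + a')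
          (Or.inr (Or.inr (Or.inl ⟨a', ha', rfl⟩))) (by omega) (by omega) (by omega)
      · rw [if_neg (by rintro (h' | h'); exacts [by omega, hnA h'])]
        omega
  · rintro ⟨i, ⟨him, hiB⟩, rfl⟩
    split_ifs with hi
    · refine ⟨?_, by omega, fun a ha b hb ha0 hb0 h => ?_⟩
      · rcases hi with rfl | hi
        · exact self_mem_levelTwoMonoid
        · exact Or.inr (Or.inr (Or.inl ⟨i, hi, rfl⟩))
      · have := le_of_mem_levelTwoMonoid ha ha0
        have := le_of_mem_levelTwoMonoid hb hb0
        omega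
    · push Not at hi
      refine ⟨Or.inr (Or.inr (Or.inr (by omega))), by omega, fun a ha b hb ha0 hb0 h => ?_⟩
      have hma := le_of_mem_levelTwoMonoid ha ha0
      have hmb := le_of_mem_levelTwoMonoid hb hb0
      have ha' := ha
      rcases ha with ha | rfl | ⟨x, hx, rfl⟩ | ha
      · omega
      · rw [show b = a + i by omega, add_mem_levelTwoMonoid_iff (by omega) him] at hb
        exact hi.2 hb
      · rcases hb with hb | rfl | ⟨y, hy, rfl⟩ | hb
        · omega
        · exact hi.2 (by rwa [show i = x by omega])
        · exact hiB ((hB i).2 ⟨him, hi.2, x, hx, y, hy, by omega⟩)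
        · have := hA x hx
          omega
      · rcases hb with hb | rfl | ⟨y, hy, rfl⟩ | hb
        · omega
        · rw [show a = b + i by omega, add_mem_levelTwoMonoid_iff (by omega) him] at ha'
          exact hi.2 ha'
        · have := hA y hy
          omega
        · omega

lemma edim_levelTwoMonoid {B : Finset ℕ} (hA : ∀ a ∈ A, 0 < a ∧ a < m)
    (hB : ∀ b, b ∈ B ↔ b < m ∧ b ∉ A ∧ ∃ a ∈ A, ∃ a' ∈ A, b = a + a') (hm : 0 < m) :
    edim (levelTwoMonoid m A) = m - B.card := by
  rw [edim, minGens_levelTwoMonoid hA hB hm, Set.ncard_coe_finset, Finset.card_image_of_injOn,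
    Finset.card_sdiff_of_subset, Finset.card_range]
  · exact fun b hb => Finset.mem_range.2 ((hB b).1 hb).1
  · intro i hi j hj hij
    simp only [Finset.mem_coe, Finset.mem_sdiff, Finset.mem_range] at hi hj
    dsimp only at hij
    split_ifs at hij <;> omega

lemma exists_numericalMonoid {B : Finset ℕ} {e : ℕ} (hA : ∀ a ∈ A, 0 < a ∧ a < m)
    (hB : ∀ b, b ∈ B ↔ b < m ∧ b ∉ A ∧ ∃ a ∈ A, ∃ a' ∈ A, b = a + a')
    (hA' : ∀ a ∈ A, ∃ b ∈ A, a + b < m ∧ a + b ∉ A) (he : 0 < e) (hm : m = e + 1 + B.card) :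
    ∃ Γ : AddSubmonoid ℕ, IsNumericalMonoid Γ ∧ edim Γ = e + 1 ∧ mult Γ = m ∧
      numType Γ = m - 1 - A.card :=
  ⟨levelTwoMonoid m A, isNumericalMonoid_levelTwoMonoid,
    by rw [edim_levelTwoMonoid hA hB (by omega)]; omega, mult_levelTwoMonoid (by omega),
    numType_levelTwoMonoid hA hA' (by omega)⟩

end Construction

lemma numType_le_mathcalD {Γ : AddSubmonoid ℕ} {e n : ℕ} (he : 3 ≤ e) (hn : n ≤ 5)
    (hΓ : IsNumericalMonoid Γ) (hedim : edim Γ = e + 1) (hmult : mult Γ = e + 1 + n) :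
    numType Γ ≤ mathcalD e (e + 1 + n) := by
  rw [mathcalD_eq_of_small_diff he hn]
  have h1 := numType_add_ncard_nonmaximalApery_lt hΓ
  have h2 := mult_le_edim_add_choose hΓ (by omega)
  rw [hmult] at h1 h2
  rw [hedim] at h2
  generalize (nonmaximalApery Γ).ncard = k at h1 h2
  rcases lt_or_ge k 3 with hk | hk
  · interval_cases k <;> simp [Nat.choose] at h2 <;> split_ifs <;> omega
  · split_ifs <;> omega

lemma exists_numType_eq_mathcalD {e n : ℕ} (he : 3 ≤ e) (hn : n ≤ 5) :
    ∃ Γ : AddSubmonoid ℕ, IsNumericalMonoid Γ ∧ edim Γ = e + 1 ∧ mult Γ = e + 1 + n ∧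
      numType Γ = mathcalD e (e + 1 + n) := by
  rw [mathcalD_eq_of_small_diff he hn]
  suffices ∃ A B : Finset ℕ, (∀ a ∈ A, 0 < a ∧ a < e + 1 + n) ∧
      (∀ b, b ∈ B ↔ b < e + 1 + n ∧ b ∉ A ∧ ∃ a ∈ A, ∃ a' ∈ A, b = a + a') ∧
      (∀ a ∈ A, ∃ b ∈ A, a + b < e + 1 + n ∧ a + b ∉ A) ∧ B.card = n ∧
      e + n - A.card = e + if n ≤ 2 then 0 else if n ≤ 4 then 1 else 2 by
    obtain ⟨A, B, hA, hB, hA', hcB, hcA⟩ := this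
    rw [← hcA]
    obtain ⟨Γ, h1, h2, h3, h4⟩ := exists_numericalMonoid hA hB hA' (e := e) (by omega) (by omega)
    exact ⟨Γ, h1, h2, h3, by omega⟩
  interval_cases n
  · exact ⟨∅, ∅, by simp⟩
  · refine ⟨{1}, {2}, ?_, ?_, ?_, rfl, ?_⟩ <;> simp <;> omega
  · refine ⟨{1, 2}, {3, 4}, ?_, ?_, ?_, rfl, ?_⟩ <;> simp <;> omega
  · refine ⟨{2, 3}, {4, 5, 6}, ?_, ?_, ?_, rfl, ?_⟩ <;> simp <;> omega
  · have h1 : ({1, 2, e + 2} : Finset ℕ).card = 3 := Finset.card_eq_three.2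
      ⟨1, 2, e + 2, by omega, by omega, by omega, rfl⟩
    have h2 : ({3, 4, e + 3, e + 4} : Finset ℕ).card = 4 := by
      rw [Finset.card_insert_of_notMem, Finset.card_eq_three.2
        ⟨4, e + 3, e + 4, by omega, by omega, by omega, rfl⟩]
      simp
      omega
    refine ⟨{1, 2, e + 2}, {3, 4, e + 3, e + 4}, ?_, ?_, ?_, h2, ?_⟩
    · simp
    · simp
      omega
    · simp
      omega
    · rw [h1]
      simp
  · refine ⟨{1, 3, 4}, {2, 5, 6, 7, 8}, ?_, ?_, ?_, rfl, ?_⟩ <;> simp <;> omega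

/-- If 3 ≤ e < m and m - e ≤ 6, then 𝒯(e,m) = 𝒟(e,m). -/
theorem type_max_eq_D_of_small_diff (e m : ℕ) (he : 3 ≤ e) (hem : e < m) (hd : m - e ≤ 6) :
    (∀ Γ : AddSubmonoid ℕ, IsNumericalMonoid Γ →
      edim Γ = e + 1 → mult Γ = m → numType Γ ≤ mathcalD e m) ∧
    (∃ Γ : AddSubmonoid ℕ, IsNumericalMonoid Γ ∧
      edim Γ = e + 1 ∧ mult Γ = m ∧ numType Γ = mathcalD e m) := by
  obtain ⟨n, rfl⟩ := Nat.exists_eq_add_of_le (show e + 1 ≤ m from hem)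
  exact ⟨fun Γ hΓ hedim hmult => numType_le_mathcalD he (by omega) hΓ hedim hmult,
    exists_numType_eq_mathcalD he (by omega)⟩
end
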